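/- arXiv:0708.1155 — 4 statements merged into one kernel-verified Lean document; each statement's English description precedes it below -/
import Mathlib

section
/- (Local Hardy inequality, sharpness.) For every ρ ∈ (0, ρ₀) and every constant C > 1/4 there exists a smooth function φ : ℝ^N → ℝ, not identically zero, with compact support contained in Ω_ρ, such that ∫_{Ω_ρ} |∇φ(x)|² dx < C ∫_{Ω_ρ} φ(x)²/δ(x)² dx. Consequently the optimal constant in the local Hardy inequality on Ω_ρ equals 1/4 for all sufficiently small ρ. -/
open Set Metric MeasureTheory Real

noncomputable section

/-- Distance to the boundary of `Ω`. -/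
def bdist {N : ℕ} (Ω : Set (EuclideanSpace ℝ (Fin N))) (x : EuclideanSpace ℝ (Fin N)) : ℝ :=
  Metric.infDist x Ωᶜ

/-- The collar `Ω_ρ = {x ∈ Ω : δ(x) < ρ}`. -/
def collar {N : ℕ} (Ω : Set (EuclideanSpace ℝ (Fin N))) (ρ : ℝ) :
    Set (EuclideanSpace ℝ (Fin N)) :=
  {x ∈ Ω | bdist Ω x < ρ}

/-- The ring `Ω_{ε,ρ} = {x ∈ Ω : ε < δ(x) < ρ}`. -/
def ring' {N : ℕ} (Ω : Set (EuclideanSpace ℝ (Fin N))) (ε ρ : ℝ) :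
    Set (EuclideanSpace ℝ (Fin N)) :=
  {x ∈ Ω | ε < bdist Ω x ∧ bdist Ω x < ρ}

/-- The Laplacian. -/
def lap {N : ℕ} (f : EuclideanSpace ℝ (Fin N) → ℝ) (x : EuclideanSpace ℝ (Fin N)) : ℝ :=
  ∑ i : Fin N, fderiv ℝ (fun y => fderiv ℝ f y (EuclideanSpace.single i 1)) x
    (EuclideanSpace.single i 1)

/-- `ρ₀` is a good collar width: `δ` is `C²` on `Ω_{ρ₀}`, `|∇δ| = 1` there, `Δδ` bounded. -/
def GoodCollar {N : ℕ} (Ω : Set (EuclideanSpace ℝ (Fin N))) (ρ₀ : ℝ) : Prop :=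
  0 < ρ₀ ∧ ContDiffOn ℝ 2 (bdist Ω) (collar Ω ρ₀) ∧
    (∀ x ∈ collar Ω ρ₀, ‖gradient (bdist Ω) x‖ = 1) ∧
    ∃ M, ∀ x ∈ collar Ω ρ₀, |lap (bdist Ω) x| ≤ M

/-- A super-harmonic of `L_μ = -Δ - μ/δ²` on `G`. -/
def SuperHarm {N : ℕ} (Ω : Set (EuclideanSpace ℝ (Fin N))) (μ : ℝ)
    (G : Set (EuclideanSpace ℝ (Fin N))) (h : EuclideanSpace ℝ (Fin N) → ℝ) : Prop :=
  ContDiffOn ℝ 2 h G ∧ ∀ x ∈ G, 0 ≤ -(lap h x) - μ / (bdist Ω x) ^ 2 * h x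

/-- A sub-harmonic of `L_μ = -Δ - μ/δ²` on `G`. -/
def SubHarm {N : ℕ} (Ω : Set (EuclideanSpace ℝ (Fin N))) (μ : ℝ)
    (G : Set (EuclideanSpace ℝ (Fin N))) (h : EuclideanSpace ℝ (Fin N) → ℝ) : Prop :=
  ContDiffOn ℝ 2 h G ∧ ∀ x ∈ G, -(lap h x) - μ / (bdist Ω x) ^ 2 * h x ≤ 0

/-- A positive local super-harmonic of `L_μ`, defined on the collar `Ω_σ`. -/
def PosSuperHarmOn {N : ℕ} (Ω : Set (EuclideanSpace ℝ (Fin N))) (μ σ : ℝ)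
    (h : EuclideanSpace ℝ (Fin N) → ℝ) : Prop :=
  SuperHarm Ω μ (collar Ω σ) h ∧ ∀ x ∈ collar Ω σ, 0 < h x

/-- A sub-solution of `(*)`: `-Δu - (μ/δ²)u + u^p/δ^s = 0` on `G`. -/
def SubSol {N : ℕ} (Ω : Set (EuclideanSpace ℝ (Fin N))) (μ s p : ℝ)
    (G : Set (EuclideanSpace ℝ (Fin N))) (u : EuclideanSpace ℝ (Fin N) → ℝ) : Prop :=
  ContDiffOn ℝ 2 u G ∧ (∀ x ∈ G, 0 ≤ u x) ∧
    ∀ x ∈ G, -(lap u x) - μ / (bdist Ω x) ^ 2 * u x + (u x) ^ p / (bdist Ω x) ^ s ≤ 0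

/-- A super-solution of `(*)` on `G`. -/
def SuperSol {N : ℕ} (Ω : Set (EuclideanSpace ℝ (Fin N))) (μ s p : ℝ)
    (G : Set (EuclideanSpace ℝ (Fin N))) (u : EuclideanSpace ℝ (Fin N) → ℝ) : Prop :=
  ContDiffOn ℝ 2 u G ∧ (∀ x ∈ G, 0 < u x) ∧
    ∀ x ∈ G, 0 ≤ -(lap u x) - μ / (bdist Ω x) ^ 2 * u x + (u x) ^ p / (bdist Ω x) ^ s

/-- A regularized distance `(d, c)` on `Ω`. -/
def RegDist {N : ℕ} (Ω : Set (EuclideanSpace ℝ (Fin N))) (d : EuclideanSpace ℝ (Fin N) → ℝ)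
    (c : ℝ) : Prop :=
  1 ≤ c ∧ ContDiffOn ℝ 2 d Ω ∧ (∀ x ∈ Ω, 0 < d x) ∧
    (∀ x ∈ Ω, c⁻¹ * bdist Ω x ≤ d x ∧ d x ≤ c * bdist Ω x) ∧
    (∀ x ∈ Ω, ‖gradient d x‖ ≤ c) ∧ (∀ x ∈ Ω, |lap d x| ≤ c / d x)


lemma mollify {N : ℕ} (φ : EuclideanSpace ℝ (Fin N) → ℝ) (hφ : ContDiff ℝ 1 φ)
    (hc : HasCompactSupport φ) (d e : ℝ) (hd : 0 < d) (he : 0 < e) :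
    ∃ ψ : EuclideanSpace ℝ (Fin N) → ℝ, ContDiff ℝ (⊤ : ℕ∞) ψ ∧
      tsupport ψ ⊆ cthickening d (tsupport φ) ∧ (∀ x, |ψ x - φ x| ≤ e) ∧
      ∀ x, ‖fderiv ℝ ψ x - fderiv ℝ φ x‖ ≤ e := by
  have hD : Continuous (fderiv ℝ φ) := hφ.continuous_fderiv (by norm_num)
  have hDc : HasCompactSupport (fderiv ℝ φ) := hc.fderiv ℝ
  have u1 := hc.uniformContinuous_of_continuous hφ.continuous
  have u2 := hDc.uniformContinuous_of_continuous hD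
  obtain ⟨d1, hd1, h1⟩ := Metric.uniformContinuous_iff.1 u1 e he
  obtain ⟨d2, hd2, h2⟩ := Metric.uniformContinuous_iff.1 u2 e he
  set r := min d (min d1 d2) with hr
  have hr0 : 0 < r := by positivity
  let b : ContDiffBump (0 : EuclideanSpace ℝ (Fin N)) := ⟨r / 2, r, by positivity, by linarith⟩
  have hb : b.rOut = r := rfl
  let ψ : EuclideanSpace ℝ (Fin N) → ℝ :=
    convolution (b.normed volume) φ (ContinuousLinearMap.lsmul ℝ ℝ) volume
  have hψd : ∀ x, HasFDerivAt ψ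
      (convolution (b.normed volume) (fderiv ℝ φ) (ContinuousLinearMap.lsmul ℝ ℝ) volume x) x := by
    intro x
    exact hc.hasFDerivAt_convolution_right (ContinuousLinearMap.lsmul ℝ ℝ)
      (b.continuous_normed.locallyIntegrable (μ := volume)) hφ x
  refine ⟨ψ, ?_, ?_, ?_, ?_⟩
  · exact b.hasCompactSupport_normed.contDiff_convolution_left _ b.contDiff_normed
      hφ.continuous.locallyIntegrable
  · apply closure_minimal _ isClosed_cthickening
    intro x hx
    by_contra hxn
    apply hx
    have hz : ∀ y ∈ ball x b.rOut, φ y = 0 := by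
      intro y hy
      by_contra hy0
      apply hxn
      have : y ∈ tsupport φ := subset_tsupport _ hy0
      refine mem_cthickening_of_dist_le x y d _ this ?_
      rw [mem_ball, hb] at hy
      rw [dist_comm]
      exact hy.le.trans (min_le_left _ _)
    have hx0 := hz x (mem_ball_self b.rOut_pos)
    have := b.normed_convolution_eq_right (μ := volume) (g := φ) (x₀ := x)
      (fun y hy => by rw [hz y hy, hx0])
    exact this.trans hx0
  · intro x
    have := b.dist_normed_convolution_le (μ := volume) (g := φ) (x₀ := x) (ε := e)
      hφ.continuous.aestronglyMeasurable (fun y hy => (h1 (by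
        rw [mem_ball, hb] at hy
        exact hy.trans_le ((min_le_right _ _).trans (min_le_left _ _)))).le)
    rwa [Real.dist_eq] at this
  · intro x
    have := b.dist_normed_convolution_le (μ := volume) (g := fderiv ℝ φ) (x₀ := x) (ε := e)
      hD.aestronglyMeasurable (fun y hy => (h2 (by
        rw [mem_ball, hb] at hy
        exact hy.trans_le ((min_le_right _ _).trans (min_le_right _ _)))).le)
    rw [(hψd x).fderiv]
    rwa [dist_eq_norm] at this

lemma norm_gradient_eq {N : ℕ} (φ : EuclideanSpace ℝ (Fin N) → ℝ) (x) :
    ‖gradient φ x‖ = ‖fderiv ℝ φ x‖ := by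
  simp [gradient]

lemma sq_sub_bound {a b e B : ℝ} (hab : |a - b| ≤ e) (hb : |b| ≤ B) (he : e ≤ 1) :
    |a ^ 2 - b ^ 2| ≤ e * (2 * B + 1) := by
  have h1 : |a + b| ≤ 2 * B + 1 := by
    calc |a + b| = |(a - b) + 2 * b| := by ring_nf
      _ ≤ |a - b| + |2 * b| := abs_add_le _ _
      _ = |a - b| + 2 * |b| := by rw [abs_mul]; norm_num
      _ ≤ 2 * B + 1 := by linarith
  rw [sq_sub_sq, abs_mul, mul_comm]
  exact mul_le_mul hab h1 (abs_nonneg _) ((abs_nonneg _).trans hab)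

lemma smooth_of_C1 {N : ℕ} (U : Set (EuclideanSpace ℝ (Fin N))) (hU : IsOpen U)
    (D : EuclideanSpace ℝ (Fin N) → ℝ) (hDc : Continuous D) (hD : ∀ x ∈ U, 0 < D x) (C : ℝ)
    (φ : EuclideanSpace ℝ (Fin N) → ℝ) (hφ : ContDiff ℝ 1 φ)
    (hc : HasCompactSupport φ) (hs : tsupport φ ⊆ U)
    (hlt : ∫ x in U, (‖fderiv ℝ φ x‖ ^ 2 - C * (φ x ^ 2 / D x ^ 2)) < 0) :
    ∃ ψ : EuclideanSpace ℝ (Fin N) → ℝ, ContDiff ℝ (⊤ : ℕ∞) ψ ∧ HasCompactSupport ψ ∧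
        tsupport ψ ⊆ U ∧ ψ ≠ 0 ∧
        ∫ x in U, ‖gradient ψ x‖ ^ 2 < C * ∫ x in U, (ψ x) ^ 2 / (D x) ^ 2 := by
  obtain ⟨d, hd, hdU⟩ := hc.isCompact.exists_cthickening_subset_open hU hs
  set K := cthickening d (tsupport φ) with hK
  have hKc : IsCompact K := hc.isCompact.cthickening
  have hφK : tsupport φ ⊆ K := self_subset_cthickening _
  -- reduction of the integrals to K
  have red : ∀ f : EuclideanSpace ℝ (Fin N) → ℝ, (∀ x ∉ K, f x = 0) →
      ∫ x in U, f x = ∫ x in K, f x := by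
    intro f hf
    rw [setIntegral_eq_integral_of_forall_compl_eq_zero (fun x hx => hf x (fun h => hx (hdU h))),
      setIntegral_eq_integral_of_forall_compl_eq_zero hf]
  have zero1 : ∀ f : EuclideanSpace ℝ (Fin N) → ℝ, tsupport f ⊆ K → ∀ x ∉ K,
      f x = 0 ∧ fderiv ℝ f x = 0 := by
    intro f hf x hx
    refine ⟨image_eq_zero_of_notMem_tsupport fun h => hx (hf h), ?_⟩
    exact fderiv_of_notMem_tsupport ℝ (fun h => hx (hf h))
  have intg : ∀ f : EuclideanSpace ℝ (Fin N) → ℝ, ContDiff ℝ 1 f →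
      IntegrableOn (fun x => ‖fderiv ℝ f x‖ ^ 2) K ∧
      IntegrableOn (fun x => f x ^ 2 / D x ^ 2) K := by
    intro f hf
    constructor
    · exact ContinuousOn.integrableOn_compact hKc
        ((hf.continuous_fderiv (by norm_num)).norm.pow 2).continuousOn
    · refine ContinuousOn.integrableOn_compact hKc ?_
      apply (hf.continuous.pow 2).continuousOn.div (hDc.pow 2).continuousOn
      intro x hx
      exact pow_ne_zero _ (hD x (hdU hx)).ne'
  obtain ⟨B1, hB1⟩ := hKc.exists_bound_of_continuousOn hφ.continuous.continuousOn
  obtain ⟨B2, hB2⟩ := hKc.exists_bound_of_continuousOn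
    (hφ.continuous_fderiv (by norm_num)).continuousOn
  obtain ⟨B3, hB3⟩ := hKc.exists_bound_of_continuousOn (f := fun x => C * (1 / D x ^ 2)) (by
    apply continuousOn_const.mul
    apply continuousOn_const.div (hDc.pow 2).continuousOn
    intro x hx
    exact pow_ne_zero _ (hD x (hdU hx)).ne')
  set J : ℝ := ∫ x in U, (‖fderiv ℝ φ x‖ ^ 2 - C * (φ x ^ 2 / D x ^ 2)) with hJ
  set Q : ℝ := |2 * B2 + 1| + |2 * B1 + 1| * |B3| with hQ
  set V : ℝ := volume.real K with hV
  have hV0 : 0 ≤ V := measureReal_nonneg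
  have hQ0 : 0 ≤ Q := by positivity
  set e : ℝ := min 1 (-J / (2 * (Q * V + 1))) with he
  have he0 : 0 < e := by
    apply lt_min one_pos
    apply div_pos (by linarith) (by positivity)
  obtain ⟨ψ, hψs, hψK, hψ1, hψ2⟩ := mollify φ hφ hc d e hd he0
  have hψs1 : ContDiff ℝ 1 ψ := hψs.of_le (by exact_mod_cast le_top)
  have hcψ : HasCompactSupport ψ := hKc.of_isClosed_subset (isClosed_tsupport _) hψK
  have main : ∫ x in U, ‖gradient ψ x‖ ^ 2 < C * ∫ x in U, (ψ x) ^ 2 / (D x) ^ 2 := by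
    simp only [norm_gradient_eq]
    rw [red _ (fun x hx => by rw [(zero1 ψ hψK x hx).2]; simp),
      red _ (fun x hx => by rw [(zero1 ψ hψK x hx).1]; simp), ← sub_neg, ← integral_const_mul,
      ← integral_sub (intg ψ hψs1).1 ((intg ψ hψs1).2.const_mul C)]
    have hJK : J = ∫ x in K, (‖fderiv ℝ φ x‖ ^ 2 - C * (φ x ^ 2 / D x ^ 2)) := by
      rw [hJ, red _ (fun x hx => by rw [(zero1 φ hφK x hx).1, (zero1 φ hφK x hx).2]; simp)]
    have i1 : IntegrableOn (fun x => ‖fderiv ℝ ψ x‖ ^ 2 - C * (ψ x ^ 2 / D x ^ 2)) K :=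
      (intg ψ hψs1).1.sub ((intg ψ hψs1).2.const_mul C)
    have i2 : IntegrableOn (fun x => ‖fderiv ℝ φ x‖ ^ 2 - C * (φ x ^ 2 / D x ^ 2)) K :=
      (intg φ hφ).1.sub ((intg φ hφ).2.const_mul C)
    have hdiff : ‖∫ x in K, ((‖fderiv ℝ ψ x‖ ^ 2 - C * (ψ x ^ 2 / D x ^ 2)) -
        (‖fderiv ℝ φ x‖ ^ 2 - C * (φ x ^ 2 / D x ^ 2)))‖ ≤ (e * Q) * V := by
      apply norm_setIntegral_le_of_norm_le_const hKc.measure_lt_top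
      intro x hx
      have a1 : |‖fderiv ℝ ψ x‖ ^ 2 - ‖fderiv ℝ φ x‖ ^ 2| ≤ e * (2 * B2 + 1) := by
        apply sq_sub_bound _ _ (min_le_left _ _)
        · exact (abs_norm_sub_norm_le _ _).trans (hψ2 x)
        · rw [abs_norm]; exact hB2 x hx
      have a2 : |ψ x ^ 2 - φ x ^ 2| ≤ e * (2 * B1 + 1) :=
        sq_sub_bound (hψ1 x) (hB1 x hx) (min_le_left _ _)
      have a3 := hB3 x hx
      rw [Real.norm_eq_abs] at a3 ⊢
      have : (‖fderiv ℝ ψ x‖ ^ 2 - C * (ψ x ^ 2 / D x ^ 2)) -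
        (‖fderiv ℝ φ x‖ ^ 2 - C * (φ x ^ 2 / D x ^ 2)) =
        (‖fderiv ℝ ψ x‖ ^ 2 - ‖fderiv ℝ φ x‖ ^ 2) -
          (ψ x ^ 2 - φ x ^ 2) * (C * (1 / D x ^ 2)) := by ring
      rw [this]
      refine (abs_sub _ _).trans ?_
      rw [abs_mul]
      have a4 : |ψ x ^ 2 - φ x ^ 2| * |C * (1 / D x ^ 2)| ≤ (e * |2 * B1 + 1|) * |B3| := by
        apply mul_le_mul _ (a3.trans (le_abs_self _)) (abs_nonneg _) (by positivity)
        exact a2.trans (mul_le_mul_of_nonneg_left (le_abs_self _) he0.le)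
      have a5 : e * (2 * B2 + 1) ≤ e * |2 * B2 + 1| :=
        mul_le_mul_of_nonneg_left (le_abs_self _) he0.le
      rw [hQ]
      linarith
    rw [integral_sub i1 i2, ← hJK, Real.norm_eq_abs] at hdiff
    have h5 := (abs_le.1 hdiff).2
    have h6 : e * (2 * (Q * V + 1)) ≤ -J := by
      rw [← le_div_iff₀ (by positivity)]
      exact min_le_right _ _
    nlinarith [mul_nonneg hQ0 hV0]
  refine ⟨ψ, hψs, hcψ, hψK.trans hdU, ?_, main⟩
  rintro rfl
  simp [gradient] at main

lemma hasDerivAt_posSq (x : ℝ) : HasDerivAt (fun y : ℝ => max y 0 ^ 2) (2 * max x 0) x := by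
  rcases lt_trichotomy x 0 with h | h | h
  · rw [max_eq_right h.le]
    have : (fun y : ℝ => max y 0 ^ 2) =ᶠ[nhds x] fun _ => 0 := by
      filter_upwards [Iio_mem_nhds h] with y hy
      rw [max_eq_right (le_of_lt hy)]; norm_num
    simpa using (hasDerivAt_const x (0 : ℝ)).congr_of_eventuallyEq this
  · subst h
    rw [hasDerivAt_iff_isLittleO_nhds_zero]
    simp only [zero_add, max_self, mul_zero, smul_eq_mul, ne_eq, OfNat.ofNat_ne_zero,
      not_false_eq_true, zero_pow, sub_zero]
    have h1 : (fun h : ℝ => max h 0 ^ 2) =O[nhds 0] fun h : ℝ => h ^ 2 := by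
      apply Asymptotics.IsBigO.of_bound 1
      refine Filter.Eventually.of_forall fun y => ?_
      rw [norm_pow, norm_pow, one_mul]
      apply pow_le_pow_left₀ (norm_nonneg _)
      rw [Real.norm_eq_abs, Real.norm_eq_abs]
      rcases le_total y 0 with h | h
      · rw [max_eq_right h]; simp
      · rw [max_eq_left h]
    refine h1.trans_isLittleO ?_
    exact Asymptotics.isLittleO_pow_id (by norm_num)
  · rw [max_eq_left h.le]
    have : (fun y : ℝ => max y 0 ^ 2) =ᶠ[nhds x] fun y => y ^ 2 := by
      filter_upwards [Ioi_mem_nhds h] with y hy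
      rw [max_eq_left (le_of_lt hy)]
    simpa using (hasDerivAt_pow 2 x).congr_of_eventuallyEq this

lemma contDiff_posSq : ContDiff ℝ 1 (fun y : ℝ => max y 0 ^ 2) := by
  rw [contDiff_one_iff_deriv]
  refine ⟨fun x => (hasDerivAt_posSq x).differentiableAt, ?_⟩
  have : deriv (fun y : ℝ => max y 0 ^ 2) = fun x => 2 * max x 0 :=
    funext fun x => (hasDerivAt_posSq x).deriv
  rw [this]
  fun_prop

def thF (c L t : ℝ) : ℝ := (Real.log t - c) / L
def PF (c L t : ℝ) : ℝ := 1 - thF c L t ^ 2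
def mF (c L t : ℝ) : ℝ := max (PF c L t) 0 ^ 2
def fF (c L t : ℝ) : ℝ := √t * mF c L t
def gF (c L t : ℝ) : ℝ := mF c L t ^ 2 / 2 - 3 / L * (thF c L t * (PF c L t * mF c L t))

def mF' (c L t : ℝ) : ℝ := 2 * max (PF c L t) 0 * (-(2 * thF c L t * (1 / t / L)))
def fF' (c L t : ℝ) : ℝ := 1 / (2 * √t) * mF c L t + √t * mF' c L t
def gF' (c L t : ℝ) : ℝ := mF c L t * mF' c L t - 3 / L * (1 / t / L * (PF c L t * mF c L t) +
  thF c L t * (-(2 * thF c L t * (1 / t / L)) * mF c L t + PF c L t * mF' c L t))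

lemma hasDerivAt_thF (c L t : ℝ) (ht : 0 < t) : HasDerivAt (thF c L) (1 / t / L) t := by
  unfold thF
  simpa using ((Real.hasDerivAt_log ht.ne').sub_const c).div_const L

lemma hasDerivAt_PF (c L t : ℝ) (ht : 0 < t) :
    HasDerivAt (PF c L) (-(2 * thF c L t * (1 / t / L))) t := by
  unfold PF
  simpa using ((hasDerivAt_thF c L t ht).pow 2).const_sub 1

lemma hasDerivAt_mF (c L t : ℝ) (ht : 0 < t) : HasDerivAt (mF c L) (mF' c L t) t := by
  exact (hasDerivAt_posSq (PF c L t)).comp t (hasDerivAt_PF c L t ht)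

lemma hasDerivAt_fF (c L t : ℝ) (ht : 0 < t) : HasDerivAt (fF c L) (fF' c L t) t := by
  exact (Real.hasDerivAt_sqrt ht.ne').mul (hasDerivAt_mF c L t ht)

lemma hasDerivAt_gF (c L t : ℝ) (ht : 0 < t) : HasDerivAt (gF c L) (gF' c L t) t := by
  have := (((hasDerivAt_mF c L t ht).pow 2).div_const 2).sub
    (((hasDerivAt_thF c L t ht).mul
      ((hasDerivAt_PF c L t ht).mul (hasDerivAt_mF c L t ht))).const_mul (3 / L))
  refine this.congr_deriv ?_
  unfold gF'
  simp
  ring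

lemma contDiffOn_thF (c L : ℝ) : ContDiffOn ℝ 1 (thF c L) (Ioi 0) := by
  unfold thF
  apply ContDiffOn.div_const
  apply ContDiffOn.sub _ contDiffOn_const
  exact contDiffOn_id.log fun x hx => (ne_of_gt hx)

lemma contDiffOn_PF (c L : ℝ) : ContDiffOn ℝ 1 (PF c L) (Ioi 0) :=
  contDiffOn_const.sub ((contDiffOn_thF c L).pow 2)

lemma contDiffOn_mF (c L : ℝ) : ContDiffOn ℝ 1 (mF c L) (Ioi 0) :=
  contDiff_posSq.comp_contDiffOn (contDiffOn_PF c L)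

lemma contDiffOn_fF (c L : ℝ) : ContDiffOn ℝ 1 (fF c L) (Ioi 0) :=
  (contDiffOn_id.sqrt fun x hx => (ne_of_gt hx)).mul (contDiffOn_mF c L)

lemma contDiffOn_gF (c L : ℝ) : ContDiffOn ℝ 1 (gF c L) (Ioi 0) :=
  (((contDiffOn_mF c L).pow 2).div_const 2).sub (contDiffOn_const.mul
    ((contDiffOn_thF c L).mul ((contDiffOn_PF c L).mul (contDiffOn_mF c L))))

lemma PF_nonpos (c L t : ℝ) (hL : 0 < L) (hc : c ≤ -L) (ht : 0 ≤ t)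
    (h : t ∉ Icc (exp (c - L)) (exp (c + L))) : PF c L t ≤ 0 := by
  unfold PF
  have key : 1 ≤ |thF c L t| := by
    unfold thF
    rw [abs_div, abs_of_pos hL, le_div_iff₀ hL, one_mul]
    rcases ht.eq_or_lt with h0 | h0
    · rw [← h0, Real.log_zero, zero_sub, abs_neg, abs_of_nonpos (by linarith)]; linarith
    · rw [mem_Icc, not_and_or, not_le, not_le] at h
      rcases h with h | h
      · have := (Real.log_lt_iff_lt_exp h0).2 h
        rw [abs_of_nonpos (by linarith)]; linarith
      · have := (Real.lt_log_iff_exp_lt h0).2 h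
        exact le_trans (by linarith) (le_abs_self _)
  have := (one_le_sq_iff_one_le_abs _).2 key
  linarith

lemma PF_zero {c L t : ℝ} (h : PF c L t ≤ 0) :
    mF c L t = 0 ∧ fF c L t = 0 ∧ gF c L t = 0 ∧ fF' c L t = 0 ∧ gF' c L t = 0 := by
  have hm : max (PF c L t) 0 = 0 := max_eq_right h
  simp [fF, gF, fF', gF', mF', mF, hm]

lemma pointwise (c L t C lam η : ℝ) (hL : 0 < L) (ht : 0 < t)
    (hη : |t * lam| ≤ η) (hηε : η ≤ C - 1 / 4) (hηL : η * L ≤ 1 / 3)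
    (hε : 10 ≤ (C - 1 / 4) * L ^ 2) (hP : 0 < PF c L t) :
    0 < C * (fF c L t ^ 2 / t ^ 2) - fF' c L t ^ 2 + (gF' c L t + gF c L t * lam) := by
  set th := thF c L t with hth
  set P := PF c L t with hPd
  have hP1 : P = 1 - th ^ 2 := rfl
  have hm : max P 0 = P := max_eq_left hP.le
  obtain ⟨u, hu, hut⟩ : ∃ u, 0 < u ∧ √t = u := ⟨√t, Real.sqrt_pos.2 ht, rfl⟩
  have htu : t = u ^ 2 := by rw [← hut, Real.sq_sqrt ht.le]
  have e : C * (fF c L t ^ 2 / t ^ 2) - fF' c L t ^ 2 + (gF' c L t + gF c L t * lam)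
      = P ^ 2 / (t * L ^ 2) * ((C - 1 / 4) * L ^ 2 * P ^ 2 + 2 * th ^ 2 - 3 * P +
        (t * lam) * L * (P ^ 2 * L / 2 - 3 * th * P)) := by
    simp only [fF, gF, fF', gF', mF', mF, ← hPd, ← hth, hm, hut]
    rw [htu]
    field_simp
    ring
  rw [e]
  have hη0 : 0 ≤ η := (abs_nonneg _).trans hη
  have hth1 : |th| ≤ 1 := by
    rw [← sq_le_one_iff_abs_le_one]; linarith
  have b1 : |(t * lam) * L * (P ^ 2 * L / 2 - 3 * th * P)| ≤
      η * L * (P ^ 2 * L / 2 + 3 * P) := by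
    rw [abs_mul, abs_mul, abs_of_pos hL]
    apply mul_le_mul (mul_le_mul_of_nonneg_right hη hL.le) _ (abs_nonneg _) (by positivity)
    refine (abs_sub _ _).trans ?_
    rw [abs_mul (3 * th), abs_mul 3 th, abs_of_pos hP, abs_of_nonneg (by positivity)]
    rw [abs_of_pos (by norm_num : (0 : ℝ) < 3)]
    nlinarith
  have b2 := (abs_le.1 b1).1
  have b3 : η * L * (P ^ 2 * L / 2) ≤ (C - 1 / 4) * L ^ 2 * P ^ 2 / 2 := by
    have : 0 ≤ L ^ 2 * P ^ 2 := by positivity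
    nlinarith
  have b4 : η * L * (3 * P) ≤ P := by nlinarith
  have b5 : 5 * P ^ 2 ≤ (C - 1 / 4) * L ^ 2 * P ^ 2 / 2 := by
    have : 0 ≤ P ^ 2 := by positivity
    nlinarith
  apply mul_pos (by positivity)
  nlinarith [sq_nonneg (5 * P - 3)]

lemma div_zero_int {N : ℕ} (F : EuclideanSpace ℝ (Fin N) → ℝ) (hF : ContDiff ℝ 1 F)
    (hc : HasCompactSupport F) (v : EuclideanSpace ℝ (Fin N)) :
    Continuous (fun x => fderiv ℝ F x v) ∧ HasCompactSupport (fun x => fderiv ℝ F x v) ∧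
    Integrable (fun x => fderiv ℝ F x v) ∧ ∫ x, fderiv ℝ F x v = 0 := by
  have h1 : Continuous (fun x => fderiv ℝ F x v) :=
    (hF.continuous_fderiv (by norm_num)).clm_apply continuous_const
  have h2 : HasCompactSupport (fun x => fderiv ℝ F x v) := hc.fderiv_apply ℝ v
  have h3 := h1.integrable_of_hasCompactSupport h2 (μ := volume)
  refine ⟨h1, h2, h3, ?_⟩
  have := integral_mul_fderiv_eq_neg_fderiv_mul_of_integrable (μ := volume)
    (f := fun _ : EuclideanSpace ℝ (Fin N) => (1 : ℝ)) (g := F) (v := v)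
    (by simp) (by simpa using h3)
    (by simpa using hF.continuous.integrable_of_hasCompactSupport hc)
    (fun x _ => by fun_prop) (fun x _ => (hF.differentiable (by norm_num)) x)
  simpa using this

section geom
variable {N : ℕ} {Ω : Set (EuclideanSpace ℝ (Fin N))}

lemma continuous_bdist : Continuous (bdist Ω) := Metric.continuous_infDist_pt _

lemma bdist_nonneg (x) : 0 ≤ bdist Ω x := Metric.infDist_nonneg

lemma bdist_pos (hΩo : IsOpen Ω) (hne : Ωᶜ.Nonempty) {x} : x ∈ Ω ↔ 0 < bdist Ω x := by
  have := hΩo.isClosed_compl.notMem_iff_infDist_pos hne (x := x)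
  rw [notMem_compl_iff] at this
  exact this

lemma isOpen_collar (hΩo : IsOpen Ω) (ρ : ℝ) : IsOpen (collar Ω ρ) :=
  hΩo.inter (isOpen_lt continuous_bdist continuous_const)

lemma exists_small (hΩo : IsOpen Ω) (hΩne : Ω.Nonempty) (hne : Ωᶜ.Nonempty) (r : ℝ) (hr : 0 < r) :
    ∃ x, 0 < bdist Ω x ∧ bdist Ω x < r := by
  obtain ⟨x, hx⟩ := hΩne
  have hx0 := (bdist_pos hΩo hne).1 hx
  obtain ⟨y, hy, hxy⟩ := hΩo.isClosed_compl.exists_infDist_eq_dist hne x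
  change bdist Ω x = _ at hxy
  set s : ℝ := min 1 (r / (2 * bdist Ω x)) with hs
  have hs0 : 0 < s := lt_min one_pos (by positivity)
  have hs1 : s ≤ 1 := min_le_left _ _
  set z := y + s • (x - y) with hz
  have d1 : dist z y = s * bdist Ω x := by
    rw [hxy, dist_eq_norm, dist_eq_norm, hz, add_sub_cancel_left, norm_smul,
      Real.norm_of_nonneg hs0.le]
  have d2 : dist x z = (1 - s) * bdist Ω x := by
    have : x - z = (1 - s) • (x - y) := by rw [hz, sub_smul, one_smul]; abel
    rw [hxy, dist_eq_norm, dist_eq_norm, this, norm_smul, Real.norm_of_nonneg (by linarith)]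
  have l1 : bdist Ω z ≤ dist z y := Metric.infDist_le_dist_of_mem hy
  have l2 : bdist Ω x ≤ bdist Ω z + dist x z := Metric.infDist_le_infDist_add_dist
  refine ⟨z, ?_, ?_⟩
  · have := mul_pos hs0 hx0
    nlinarith
  · have : s * (2 * bdist Ω x) ≤ r := by
      rw [← le_div_iff₀ (by positivity)]; exact min_le_right _ _
    nlinarith

lemma glue (hΩo : IsOpen Ω) (hne : Ωᶜ.Nonempty) (hΩb : Bornology.IsBounded Ω)
    {ρ a b : ℝ} (ha : 0 < a) (hb : b < ρ) (F : EuclideanSpace ℝ (Fin N) → ℝ)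
    (hF : ContDiffOn ℝ 1 F (collar Ω ρ)) (h0 : ∀ x, bdist Ω x ∉ Icc a b → F x = 0) :
    ContDiff ℝ 1 F ∧ HasCompactSupport F ∧ tsupport F ⊆ {x | bdist Ω x ∈ Icc a b} := by
  have hcl : IsClosed {x | bdist Ω x ∈ Icc a b} := isClosed_Icc.preimage continuous_bdist
  have hts : tsupport F ⊆ {x | bdist Ω x ∈ Icc a b} := by
    apply closure_minimal _ hcl
    intro x hx
    by_contra h
    exact hx (h0 x h)
  refine ⟨?_, ?_, hts⟩
  · rw [contDiff_iff_contDiffAt]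
    intro x
    by_cases hx : bdist Ω x ∈ Icc a b
    · apply hF.contDiffAt ((isOpen_collar hΩo ρ).mem_nhds ?_)
      exact ⟨(bdist_pos hΩo hne).2 (ha.trans_le hx.1), hx.2.trans_lt hb⟩
    · have : F =ᶠ[nhds x] fun _ => 0 := by
        filter_upwards [hcl.isOpen_compl.mem_nhds hx] with y hy
        exact h0 y hy
      exact contDiffAt_const.congr_of_eventuallyEq this
  · have : IsCompact {x | bdist Ω x ∈ Icc a b} := by
      apply Metric.isCompact_of_isClosed_isBounded hcl
      apply hΩb.subset
      intro x hx
      exact (bdist_pos hΩo hne).2 (ha.trans_le hx.1)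
    exact this.of_isClosed_subset (isClosed_tsupport _) hts

end geom

/-- (Local Hardy inequality, sharpness.) For every `ρ ∈ (0, ρ₀)` and
every `C > 1/4` there is a nonzero smooth `φ` compactly supported in `Ω_ρ` with
`∫ |∇φ|² < C ∫ φ²/δ²`; hence the optimal local Hardy constant equals `1/4`. -/
theorem stmt2 {N : ℕ} (hN : 2 ≤ N) (Ω : Set (EuclideanSpace ℝ (Fin N)))
    (hΩo : IsOpen Ω) (hΩne : Ω.Nonempty) (hΩb : Bornology.IsBounded Ω)
    (ρ₀ : ℝ) (hρ₀ : GoodCollar Ω ρ₀) :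
    ∀ ρ, 0 < ρ → ρ < ρ₀ → ∀ C : ℝ, 1 / 4 < C →
      ∃ φ : EuclideanSpace ℝ (Fin N) → ℝ, ContDiff ℝ (⊤ : ℕ∞) φ ∧ HasCompactSupport φ ∧
        tsupport φ ⊆ collar Ω ρ ∧ φ ≠ 0 ∧
        ∫ x in collar Ω ρ, ‖gradient φ x‖ ^ 2 <
          C * ∫ x in collar Ω ρ, (φ x) ^ 2 / (bdist Ω x) ^ 2 := by
  intro ρ hρ hρρ₀ C hC
  obtain ⟨hρ₀0, hδ, hgrad, M, hM⟩ := hρ₀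
  have : Nonempty (Fin N) := ⟨⟨0, by omega⟩⟩
  have hne : Ωᶜ.Nonempty := by
    rw [nonempty_compl]
    rintro rfl
    exact NormedSpace.unbounded_univ ℝ (EuclideanSpace ℝ (Fin N)) hΩb
  have hε : 0 < C - 1 / 4 := by linarith
  obtain ⟨L, hL, hεL⟩ : ∃ L : ℝ, 0 < L ∧ 10 ≤ (C - 1 / 4) * L ^ 2 := by
    refine ⟨10 / (C - 1 / 4) + 1, by positivity, ?_⟩
    have h1 : (C - 1 / 4) * (10 / (C - 1 / 4)) = 10 := mul_div_cancel₀ 10 hε.ne'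
    have h2 : 0 < 10 / (C - 1 / 4) := by positivity
    nlinarith
  obtain ⟨η, hη0, hηε, hηL⟩ : ∃ η : ℝ, 0 < η ∧ η ≤ C - 1 / 4 ∧ η * L ≤ 1 / 3 := by
    refine ⟨min (C - 1 / 4) (1 / 3 / L), by positivity, min_le_left _ _, ?_⟩
    rw [← le_div_iff₀ hL]; exact min_le_right _ _
  obtain ⟨x₀, hx₀, hx₀r⟩ := exists_small hΩo hΩne hne
    (min (min ρ 1) (η / (|M| + 1)) * exp (-L)) (by positivity)
  set c := Real.log (bdist Ω x₀) with hc
  set a := exp (c - L) with ha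
  set b := exp (c + L) with hb
  have hbr : b < min (min ρ 1) (η / (|M| + 1)) := by
    rw [hb, exp_add, hc, exp_log hx₀]
    rw [exp_neg, ← div_eq_mul_inv, lt_div_iff₀ (exp_pos L)] at hx₀r
    exact hx₀r
  have hb1 : b < ρ := hbr.trans_le ((min_le_left _ _).trans (min_le_left _ _))
  have hb2 : b < 1 := hbr.trans_le ((min_le_left _ _).trans (min_le_right _ _))
  have hb3 : b * (|M| + 1) ≤ η := by
    rw [← le_div_iff₀ (by positivity)]; exact (hbr.trans_le (min_le_right _ _)).le
  have hcL : c ≤ -L := by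
    have := (Real.exp_lt_one_iff).1 hb2
    linarith
  have ha0 : 0 < a := exp_pos _
  have hbρ₀ : b < ρ₀ := hb1.trans hρρ₀
  have hPn : ∀ x, bdist Ω x ∉ Icc a b → PF c L (bdist Ω x) ≤ 0 := fun x hx =>
    PF_nonpos c L _ hL hcL (bdist_nonneg x) hx
  have hUo := isOpen_collar hΩo ρ₀
  have hpos : ∀ x ∈ collar Ω ρ₀, 0 < bdist Ω x := fun x hx => (bdist_pos hΩo hne).1 hx.1
  have hδ1 : ContDiffOn ℝ 1 (bdist Ω) (collar Ω ρ₀) := hδ.of_le (by norm_num)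
  have hmaps : MapsTo (bdist Ω) (collar Ω ρ₀) (Ioi 0) := hpos
  have hδd : ∀ x ∈ collar Ω ρ₀, DifferentiableAt ℝ (bdist Ω) x := fun x hx =>
    (hδ1.differentiableOn (by norm_num)).differentiableAt (hUo.mem_nhds hx)
  have hDδ : ∀ v, ContDiffOn ℝ 1 (fun y => fderiv ℝ (bdist Ω) y v) (collar Ω ρ₀) := fun v =>
    (hδ.fderiv_of_isOpen hUo (by norm_num)).clm_apply contDiffOn_const
  -- the test function
  set φ : EuclideanSpace ℝ (Fin N) → ℝ := fun x => fF c L (bdist Ω x) with hφ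
  obtain ⟨φ1, φ2, φ3⟩ := glue hΩo hne hΩb ha0 hbρ₀ φ
    ((contDiffOn_fF c L).comp hδ1 hmaps) (fun x hx => (PF_zero (hPn x hx)).2.1)
  obtain ⟨q1, q2, q3⟩ := glue hΩo hne hΩb ha0 hbρ₀ (fun x => φ x ^ 2 / bdist Ω x ^ 2)
    ((φ1.contDiffOn.pow 2).div (hδ1.pow 2) (fun x hx => pow_ne_zero _ (hpos x hx).ne'))
    (fun x hx => by
      have : φ x = 0 := (PF_zero (hPn x hx)).2.1
      simp [this])
  -- the vector field
  set F : Fin N → EuclideanSpace ℝ (Fin N) → ℝ := fun i x =>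
    gF c L (bdist Ω x) * fderiv ℝ (bdist Ω) x (EuclideanSpace.single i 1) with hF
  have hFg : ∀ i, ContDiff ℝ 1 (F i) ∧ HasCompactSupport (F i) ∧
      tsupport (F i) ⊆ {x | bdist Ω x ∈ Icc a b} := fun i =>
    glue hΩo hne hΩb ha0 hbρ₀ (F i)
      (((contDiffOn_gF c L).comp hδ1 hmaps).mul (hDδ _))
      (fun x hx => by
        have : gF c L (bdist Ω x) = 0 := (PF_zero (hPn x hx)).2.2.1
        simp [hF, this])
  have hdiv := fun i => div_zero_int (F i) (hFg i).1 (hFg i).2.1 (EuclideanSpace.single i 1)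
  set DF : EuclideanSpace ℝ (Fin N) → ℝ := fun x =>
    ∑ i, fderiv ℝ (F i) x (EuclideanSpace.single i 1) with hDF
  have DFint : Integrable DF := integrable_finsetSum _ fun i _ => (hdiv i).2.2.1
  have DF0 : ∫ x, DF x = 0 := by
    rw [hDF, integral_finsetSum _ fun i _ => (hdiv i).2.2.1]
    exact Finset.sum_eq_zero fun i _ => (hdiv i).2.2.2
  have DFc : Continuous DF := continuous_finsetSum _ fun i _ => (hdiv i).1
  -- values on the collar
  have val1 : ∀ x ∈ collar Ω ρ₀, ‖fderiv ℝ φ x‖ ^ 2 = fF' c L (bdist Ω x) ^ 2 := by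
    intro x hx
    have h := (hasDerivAt_fF c L _ (hpos x hx)).comp_hasFDerivAt x (hδd x hx).hasFDerivAt
    have h' : fderiv ℝ φ x = fF' c L (bdist Ω x) • fderiv ℝ (bdist Ω) x := h.fderiv
    rw [h', norm_smul, ← norm_gradient_eq, hgrad x hx, mul_one, Real.norm_eq_abs, sq_abs]
  have val2 : ∀ x ∈ collar Ω ρ₀, DF x = gF' c L (bdist Ω x) +
      gF c L (bdist Ω x) * lap (bdist Ω) x := by
    intro x hx
    have h1 := (hasDerivAt_gF c L _ (hpos x hx)).comp_hasFDerivAt x (hδd x hx).hasFDerivAt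
    have h3 : ∑ i, fderiv ℝ (bdist Ω) x (EuclideanSpace.single i 1) ^ 2 = 1 := by
      have h4 := EuclideanSpace.real_norm_sq_eq (gradient (bdist Ω) x)
      rw [hgrad x hx] at h4
      refine Eq.trans ?_ (h4.symm.trans (one_pow 2))
      refine Finset.sum_congr rfl fun i _ => ?_
      congr 1
      have : inner ℝ (gradient (bdist Ω) x) (EuclideanSpace.single i (1 : ℝ)) =
          fderiv ℝ (bdist Ω) x (EuclideanSpace.single i 1) := by
        simp [gradient]
      rw [← this, EuclideanSpace.inner_single_right]
      simp
    have h5 : ∀ i, fderiv ℝ (F i) x (EuclideanSpace.single i 1) =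
        gF' c L (bdist Ω x) * fderiv ℝ (bdist Ω) x (EuclideanSpace.single i 1) ^ 2 +
        gF c L (bdist Ω x) * fderiv ℝ (fun y => fderiv ℝ (bdist Ω) y (EuclideanSpace.single i 1)) x
          (EuclideanSpace.single i 1) := by
      intro i
      have h2 := (((hDδ (EuclideanSpace.single i 1)).differentiableOn
        (by norm_num)).differentiableAt (hUo.mem_nhds hx)).hasFDerivAt
      have h6 := h1.mul h2
      have h7 : fderiv ℝ (F i) x = _ := h6.fderiv
      rw [h7]
      simp
      ring
    simp only [hDF, h5]
    rw [Finset.sum_add_distrib, ← Finset.mul_sum, ← Finset.mul_sum, h3, mul_one]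
    rfl
  have off : ∀ x, bdist Ω x ∉ Icc a b → ‖fderiv ℝ φ x‖ ^ 2 = 0 ∧ φ x ^ 2 / bdist Ω x ^ 2 = 0 ∧
      DF x = 0 := by
    intro x hx
    refine ⟨?_, ?_, ?_⟩
    · rw [fderiv_of_notMem_tsupport ℝ (fun h => hx (φ3 h))]; simp
    · have : φ x = 0 := (PF_zero (hPn x hx)).2.1
      simp [this]
    · refine Finset.sum_eq_zero fun i _ => ?_
      rw [fderiv_of_notMem_tsupport ℝ (fun h => hx ((hFg i).2.2 h))]; simp
  set H : EuclideanSpace ℝ (Fin N) → ℝ := fun x =>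
    C * (φ x ^ 2 / bdist Ω x ^ 2) - ‖fderiv ℝ φ x‖ ^ 2 + DF x with hH
  have Hpos : ∀ x, 0 < PF c L (bdist Ω x) → 0 < H x := by
    intro x hP
    have hx : bdist Ω x ∈ Icc a b := by
      by_contra h
      exact absurd (hPn x h) (not_le.2 hP)
    have hxU : x ∈ collar Ω ρ₀ :=
      ⟨(bdist_pos hΩo hne).2 (ha0.trans_le hx.1), hx.2.trans_lt hbρ₀⟩
    simp only [hH, val1 x hxU, val2 x hxU]
    refine pointwise c L _ C _ η hL (hpos x hxU) ?_ hηε hηL hεL hP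
    rw [abs_mul, abs_of_pos (hpos x hxU)]
    refine le_trans (mul_le_mul hx.2 ?_ (abs_nonneg _) (exp_pos _).le) hb3
    have := hM x hxU
    have := le_abs_self M
    linarith
  have Hnn : 0 ≤ H := by
    intro x
    by_cases hP : 0 < PF c L (bdist Ω x)
    · exact (Hpos x hP).le
    · by_cases hx : bdist Ω x ∈ Icc a b
      · have hxU : x ∈ collar Ω ρ₀ :=
          ⟨(bdist_pos hΩo hne).2 (ha0.trans_le hx.1), hx.2.trans_lt hbρ₀⟩
        obtain ⟨z1, z2, z3, z4, z5⟩ := PF_zero (not_lt.1 hP)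
        have hφx : φ x = 0 := z2
        simp only [hH, val1 x hxU, val2 x hxU, hφx, z3, z4, z5]
        simp
      · simp [hH, off x hx]
  have i1 : Integrable (fun x => φ x ^ 2 / bdist Ω x ^ 2) :=
    q1.continuous.integrable_of_hasCompactSupport q2
  have c2 : Continuous (fun x => ‖fderiv ℝ φ x‖ ^ 2) :=
    (φ1.continuous_fderiv (by norm_num)).norm.pow 2
  have i2 : Integrable (fun x => ‖fderiv ℝ φ x‖ ^ 2) :=
    c2.integrable_of_hasCompactSupport ((φ2.fderiv ℝ).comp_left (g := fun l => ‖l‖ ^ 2) (by simp))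
  have Hc : Continuous H := ((continuous_const.mul q1.continuous).sub c2).add DFc
  have Hi : Integrable H := ((i1.const_mul C).sub i2).add DFint
  have Hx₀ : H x₀ ≠ 0 := by
    apply (Hpos x₀ _).ne'
    simp [PF, thF, hc]
  have Hint : 0 < ∫ x, H x := integral_pos_of_integrable_nonneg_nonzero Hc Hi Hnn Hx₀
  have Hint2 : ∫ x, H x = - ∫ x, (‖fderiv ℝ φ x‖ ^ 2 - C * (φ x ^ 2 / bdist Ω x ^ 2)) := by
    have e1 : ∫ x, H x = (∫ x, (C * (φ x ^ 2 / bdist Ω x ^ 2) - ‖fderiv ℝ φ x‖ ^ 2)) + ∫ x, DF x :=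
      integral_add ((i1.const_mul C).sub i2) DFint
    rw [e1, DF0, add_zero, ← integral_neg]
    congr 1
    funext x
    ring
  have hsub : {x | bdist Ω x ∈ Icc a b} ⊆ collar Ω ρ := fun x hx =>
    ⟨(bdist_pos hΩo hne).2 (ha0.trans_le hx.1), hx.2.trans_lt hb1⟩
  refine smooth_of_C1 (collar Ω ρ) (isOpen_collar hΩo ρ) (bdist Ω) continuous_bdist
    (fun x hx => (bdist_pos hΩo hne).1 hx.1) C φ φ1 φ2 (φ3.trans hsub) ?_
  rw [setIntegral_eq_integral_of_forall_compl_eq_zero]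
  · linarith
  · intro x hx
    have := off x fun h => hx (hsub h)
    rw [this.1, this.2.1]; simp
end
end

section
/- (Comparison principle.) Let μ, s ∈ ℝ and p > 1. Let G be a nonempty open set whose closure Ḡ is a compact subset of Ω. Let u, v ∈ C(Ḡ) ∩ C²(G) with u ≥ 0 on G, v > 0 on G, where u is a sub-solution and v is a super-solution of (*) on G, and u ≤ v on ∂G. Then u ≤ v on G. (No restriction μ ≤ 1/4 is required.) -/
open Set Metric MeasureTheory Real

noncomputable section

lemma int_fderiv_zero {N : ℕ} (f : EuclideanSpace ℝ (Fin N) → ℝ) (hf : ContDiff ℝ 1 f)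
    (hc : HasCompactSupport f) (e : EuclideanSpace ℝ (Fin N)) :
    Integrable (fun x => fderiv ℝ f x e) ∧ ∫ x, fderiv ℝ f x e = 0 := by
  have hcf : Continuous (fun x => fderiv ℝ f x e) :=
    (hf.continuous_fderiv one_ne_zero).clm_apply continuous_const
  have hi : Integrable (fun x => fderiv ℝ f x e) :=
    hcf.integrable_of_hasCompactSupport (hc.fderiv_apply ℝ e)
  refine ⟨hi, ?_⟩
  have := integral_mul_fderiv_eq_neg_fderiv_mul_of_integrable (𝕜 := ℝ) (μ := volume)
    (f := f) (g := fun _ => (1:ℝ)) (v := e) (by simpa using hi) (by simp)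
    (by simpa using hf.continuous.integrable_of_hasCompactSupport hc)
    (fun x _ => hf.differentiable one_ne_zero x) (fun x _ => differentiableAt_const _)
  simpa using this.symm

/-- Existence of the truncations. -/
lemma exists_trunc (ε : ℝ) (hε : 0 < ε) : ∃ κ θ Ψ : ℝ → ℝ,
    Continuous κ ∧ (∀ t, HasDerivAt θ (κ t) t) ∧ (∀ t, HasDerivAt Ψ (κ t ^ 2) t) ∧
    (∀ t, t ≤ ε → θ t = 0 ∧ Ψ t = 0) ∧
    (∀ t, 0 ≤ t → 0 ≤ θ t ∧ θ t ≤ t ∧ t - 2 * ε ≤ θ t ∧ 0 ≤ Ψ t ∧ Ψ t ≤ t ∧ t - 2 * ε ≤ Ψ t) := by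
  set κ : ℝ → ℝ := fun t => max 0 (min 1 (t / ε - 1)) with hκ
  have hc : Continuous κ := by fun_prop
  have h0 : ∀ t, 0 ≤ κ t := fun t => le_max_left _ _
  have h1 : ∀ t, κ t ≤ 1 := fun t => by simp [hκ]
  have hz : ∀ t, t ≤ ε → κ t = 0 := fun t ht => by
    have : t / ε ≤ 1 := (div_le_one hε).2 ht
    simp only [hκ]
    exact max_eq_left ((min_le_right _ _).trans (by linarith))
  have ho : ∀ t, 2 * ε ≤ t → κ t = 1 := fun t ht => by
    have : 2 ≤ t / ε := (le_div_iff₀ hε).2 ht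
    simp only [hκ]
    rw [min_eq_left (by linarith)]; simp
  have key : ∀ f : ℝ → ℝ, Continuous f → (∀ t, 0 ≤ f t) → (∀ t, f t ≤ 1) →
      (∀ t, t ≤ ε → f t = 0) → (∀ t, 2 * ε ≤ t → f t = 1) →
      ∃ F : ℝ → ℝ, (∀ t, HasDerivAt F (f t) t) ∧ (∀ t, t ≤ ε → F t = 0) ∧
        ∀ t, 0 ≤ t → 0 ≤ F t ∧ F t ≤ t ∧ t - 2 * ε ≤ F t := by
    intro f hf f0 f1 fz fo
    have hF : ∀ t, HasDerivAt (fun t => ∫ x in ε..t, f x) (f t) t := fun t =>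
      intervalIntegral.integral_hasDerivAt_right (hf.intervalIntegrable _ _)
        (hf.stronglyMeasurableAtFilter _ _) hf.continuousAt
    have hFz : ∀ t, t ≤ ε → ∫ x in ε..t, f x = 0 := fun t ht => by
      rw [intervalIntegral.integral_congr (g := fun _ => (0:ℝ))]
      · simp
      · intro x hx
        rw [uIcc_of_ge ht] at hx
        exact fz x hx.2
    refine ⟨_, hF, hFz, ?_⟩
    have hmono : Monotone (fun t => ∫ x in ε..t, f x) :=
      monotone_of_deriv_nonneg (fun t => (hF t).differentiableAt)
        (fun t => by rw [(hF t).deriv]; exact f0 t)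
    have hD : ∀ t, HasDerivAt (fun t => t - ∫ x in ε..t, f x) (1 - f t) t :=
      fun t => (hasDerivAt_id' t).sub (hF t)
    have hanti : Monotone (fun t => t - ∫ x in ε..t, f x) :=
      monotone_of_deriv_nonneg (fun t => (hD t).differentiableAt)
        (fun t => by rw [(hD t).deriv]; linarith [f1 t])
    intro t ht
    have e0 := hFz 0 hε.le
    have a1 := hmono ht
    have a2 := hanti ht
    simp only at a1 a2
    refine ⟨by linarith, by linarith, ?_⟩
    rcases le_total t (2 * ε) with h | h
    · linarith
    · have b1 := hmono (show ε ≤ 2 * ε by linarith)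
      simp only at b1
      rw [hFz ε le_rfl] at b1
      have : ∫ x in (2*ε)..t, f x = t - 2 * ε := by
        rw [intervalIntegral.integral_congr (g := fun _ => (1:ℝ))]
        · simp
        · intro x hx
          rw [uIcc_of_le h] at hx
          exact fo x hx.1
      have := intervalIntegral.integral_add_adjacent_intervals (μ := volume) (f := f)
        (hf.intervalIntegrable ε (2*ε)) (hf.intervalIntegrable (2*ε) t)
      linarith
  obtain ⟨θ, t1, t2, t3⟩ := key κ hc h0 h1 hz ho
  obtain ⟨Ψ, p1, p2, p3⟩ := key (fun t => κ t ^ 2) (by fun_prop) (fun t => sq_nonneg _)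
    (fun t => by nlinarith [h0 t, h1 t]) (fun t ht => by simp [hz t ht])
    (fun t ht => by simp [ho t ht])
  exact ⟨κ, θ, Ψ, hc, t1, p1, fun t ht => ⟨t2 t ht, p2 t ht⟩, fun t ht =>
    ⟨(t3 t ht).1, (t3 t ht).2.1, (t3 t ht).2.2, (p3 t ht).1, (p3 t ht).2.1, (p3 t ht).2.2⟩⟩

/-- The pointwise algebraic inequality. -/
lemma alg_ineq {a b m U v up vp d θ Ψ : ℝ} (hv : 0 < v) (hd : 0 < d)
    (hΨ : 0 ≤ Ψ) (hu : -a - m * U + up / d ≤ 0) (hv' : 0 ≤ -b - m * v + vp / d) :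
    θ ^ 2 * v⁻¹ * b - Ψ * (a - b) ≤
      (m - vp / v / d) * ((U - v) * Ψ - θ ^ 2) - (up - vp / v * U) / d * Ψ := by
  have h1 : θ ^ 2 * v⁻¹ * b ≤ θ ^ 2 * v⁻¹ * (- m * v + vp / d) :=
    mul_le_mul_of_nonneg_left (by linarith) (by positivity)
  have h2 : Ψ * (b - a) ≤ Ψ * ((- m * v + vp / d) - (- m * U + up / d)) :=
    mul_le_mul_of_nonneg_left (by linarith) hΨ
  have h3 : θ ^ 2 * v⁻¹ * (- m * v + vp / d) + Ψ * ((- m * v + vp / d) - (- m * U + up / d)) =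
    (m - vp / v / d) * ((U - v) * Ψ - θ ^ 2) - (up - vp / v * U) / d * Ψ := by
    field_simp; ring
  linarith

/-- A component of the vector field. -/
def vf {N : ℕ} (θ Ψ : ℝ → ℝ) (u v : EuclideanSpace ℝ (Fin N) → ℝ)
    (e y : EuclideanSpace ℝ (Fin N)) : ℝ :=
  θ (u y - v y) ^ 2 * (v y)⁻¹ * fderiv ℝ v y e
    - Ψ (u y - v y) * (fderiv ℝ u y e - fderiv ℝ v y e)

lemma c1_of_c2 {N : ℕ} {u : EuclideanSpace ℝ (Fin N) → ℝ} {x : EuclideanSpace ℝ (Fin N)}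
    (hu : ContDiffAt ℝ 2 u x) (e : EuclideanSpace ℝ (Fin N)) :
    ContDiffAt ℝ 1 (fun y => fderiv ℝ u y e) x :=
  (hu.fderiv_right (m := 1) (by norm_num)).clm_apply contDiffAt_const

lemma vf_contDiffAt {N : ℕ} {κ θ Ψ : ℝ → ℝ} {u v : EuclideanSpace ℝ (Fin N) → ℝ}
    {x : EuclideanSpace ℝ (Fin N)} (hκ : Continuous κ) (hθ : ∀ t, HasDerivAt θ (κ t) t)
    (hΨ : ∀ t, HasDerivAt Ψ (κ t ^ 2) t) (hu : ContDiffAt ℝ 2 u x) (hv : ContDiffAt ℝ 2 v x)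
    (hvx : 0 < v x) (e : EuclideanSpace ℝ (Fin N)) : ContDiffAt ℝ 1 (vf θ Ψ u v e) x := by
  have c1 : ∀ (F f : ℝ → ℝ), Continuous f → (∀ t, HasDerivAt F (f t) t) → ContDiff ℝ 1 F := by
    intro F f hf hF
    rw [contDiff_one_iff_deriv]
    refine ⟨fun t => (hF t).differentiableAt, ?_⟩
    have : deriv F = f := funext fun t => (hF t).deriv
    rwa [this]
  have hθ1 := c1 θ κ hκ hθ
  have hΨ1 := c1 Ψ _ (hκ.pow 2) hΨ
  have hu1 : ContDiffAt ℝ 1 u x := hu.of_le (by norm_num)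
  have hv1 : ContDiffAt ℝ 1 v x := hv.of_le (by norm_num)
  have hw := hu1.sub hv1
  have a1 := hθ1.contDiffAt.comp x hw
  have a2 := hΨ1.contDiffAt.comp x hw
  exact (((a1.pow 2).mul (hv1.inv hvx.ne')).mul (c1_of_c2 hv e)).sub
    (a2.mul ((c1_of_c2 hu e).sub (c1_of_c2 hv e)))

lemma vf_fderiv {N : ℕ} {κ θ Ψ : ℝ → ℝ} {u v : EuclideanSpace ℝ (Fin N) → ℝ}
    {x : EuclideanSpace ℝ (Fin N)} (hθ : ∀ t, HasDerivAt θ (κ t) t)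
    (hΨ : ∀ t, HasDerivAt Ψ (κ t ^ 2) t) (hu : ContDiffAt ℝ 2 u x) (hv : ContDiffAt ℝ 2 v x)
    (hvx : 0 < v x) (e : EuclideanSpace ℝ (Fin N)) :
    fderiv ℝ (vf θ Ψ u v e) x e ≤
      θ (u x - v x) ^ 2 * (v x)⁻¹ * fderiv ℝ (fun y => fderiv ℝ v y e) x e
      - Ψ (u x - v x) * (fderiv ℝ (fun y => fderiv ℝ u y e) x e
        - fderiv ℝ (fun y => fderiv ℝ v y e) x e) := by
  have du := (hu.differentiableAt (by norm_num)).hasFDerivAt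
  have dv := (hv.differentiableAt (by norm_num)).hasFDerivAt
  have dpu := ((c1_of_c2 hu e).differentiableAt (by norm_num)).hasFDerivAt
  have dpv := ((c1_of_c2 hv e).differentiableAt (by norm_num)).hasFDerivAt
  have dw := du.sub dv
  have a1 := (hθ (u x - v x)).comp_hasFDerivAt x dw
  have a2 := (hΨ (u x - v x)).comp_hasFDerivAt x dw
  have a3 := (hasDerivAt_inv hvx.ne').comp_hasFDerivAt x dv
  have H := (((a1.mul a1).mul a3).mul dpv).sub (a2.mul (dpu.sub dpv))
  have H' := (H.congr_of_eventuallyEq (f₁ := vf θ Ψ u v e) (.of_forall fun y => by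
    simp [vf, pow_two])).fderiv
  rw [H']
  simp only [sub_apply, add_apply,
    smul_apply, smul_eq_mul, Function.comp, Pi.mul_apply, Pi.sub_apply]
  have hv0 := hvx.ne'
  set A := fderiv ℝ u x e
  set B := fderiv ℝ v x e
  have := sq_nonneg (κ (u x - v x) * (A - B) - θ (u x - v x) * (v x)⁻¹ * B)
  rw [← inv_pow]
  nlinarith [this]

set_option maxHeartbeats 2000000 in
/-- (Comparison principle.) Let `μ, s ∈ ℝ` and `p > 1`. Let `G` be a
nonempty open set with compact closure contained in `Ω`. Let `u, v` be continuous on the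
closure of `G`, with `u` a (nonnegative) sub-solution and `v` a (positive) super-solution
of `(*)` on `G`, and `u ≤ v` on `∂G`. Then `u ≤ v` on `G`. -/
theorem stmt10 {N : ℕ} (hN : 2 ≤ N) (Ω : Set (EuclideanSpace ℝ (Fin N)))
    (hΩo : IsOpen Ω) (hΩne : Ω.Nonempty) (hΩb : Bornology.IsBounded Ω)
    (μ s p : ℝ) (hp : 1 < p)
    (G : Set (EuclideanSpace ℝ (Fin N))) (hGne : G.Nonempty) (hGo : IsOpen G)
    (hGc : IsCompact (closure G)) (hGΩ : closure G ⊆ Ω)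
    (u v : EuclideanSpace ℝ (Fin N) → ℝ)
    (hu_cont : ContinuousOn u (closure G)) (hv_cont : ContinuousOn v (closure G))
    (hu : SubSol Ω μ s p G u) (hv : SuperSol Ω μ s p G v)
    (hbd : ∀ x ∈ frontier G, u x ≤ v x) :
    ∀ x ∈ G, u x ≤ v x := by
  by_contra hcon
  push Not at hcon
  obtain ⟨x0, hx0G, hx0⟩ := hcon
  obtain ⟨huC, hu0, huI⟩ := hu
  obtain ⟨hvC, hv0, hvI⟩ := hv
  have hGsub : G ⊆ closure G := subset_closure
  -- positivity and continuity of the distance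
  have : Nonempty (Fin N) := ⟨⟨0, by omega⟩⟩
  have hΩc : (Ωᶜ).Nonempty := by
    rw [nonempty_compl]
    rintro rfl
    exact NormedSpace.unbounded_univ ℝ (EuclideanSpace ℝ (Fin N)) hΩb
  have hδ : ∀ x ∈ closure G, 0 < bdist Ω x := fun x hx =>
    (hΩo.isClosed_compl.notMem_iff_infDist_pos hΩc).1 (by simpa using hGΩ hx)
  have hδc : Continuous (bdist Ω) := continuous_infDist_pt _
  have hwc : ContinuousOn (fun y => u y - v y) (closure G) := hu_cont.sub hv_cont
  have hds : ContinuousOn (fun y => bdist Ω y ^ s) (closure G) :=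
    hδc.continuousOn.rpow_const fun x hx => Or.inl (hδ x hx).ne'
  have hds0 : ∀ x ∈ closure G, 0 < bdist Ω x ^ s := fun x hx => rpow_pos_of_pos (hδ x hx) s
  have hvp : ContinuousOn (fun y => v y ^ (p - 1)) (closure G) :=
    hv_cont.rpow_const fun x hx => Or.inr (by linarith)
  have hup : ContinuousOn (fun y => u y ^ p) (closure G) :=
    hu_cont.rpow_const fun x hx => Or.inr (by linarith)
  have hVc : ContinuousOn
      (fun y => μ / bdist Ω y ^ 2 - v y ^ (p - 1) / bdist Ω y ^ s) (closure G) :=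
    (continuousOn_const.div (hδc.pow 2).continuousOn
      fun x hx => pow_ne_zero _ (hδ x hx).ne').sub (hvp.div hds fun x hx => (hds0 x hx).ne')
  set g : EuclideanSpace ℝ (Fin N) → ℝ :=
    fun y => (u y ^ p - v y ^ (p - 1) * u y) / bdist Ω y ^ s with hg
  have hgc : ContinuousOn g (closure G) :=
    (hup.sub (hvp.mul hu_cont)).div hds fun x hx => (hds0 x hx).ne'
  obtain ⟨C, hC⟩ := hGc.exists_bound_of_continuousOn hVc
  obtain ⟨M, hM⟩ := hGc.exists_bound_of_continuousOn hwc
  have hC0 : 0 ≤ C := (norm_nonneg _).trans (hC x0 (hGsub hx0G))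
  have hM0 : 0 ≤ M := (norm_nonneg _).trans (hM x0 (hGsub hx0G))
  -- positivity of the nonlinear term
  have hgpos : ∀ y ∈ G, v y < u y → 0 < g y := by
    intro y hy hlt
    have hvy := hv0 y hy
    have huy : 0 < u y := hvy.trans hlt
    refine div_pos ?_ (hds0 y (hGsub hy))
    have h1 : u y ^ p = u y ^ (p - 1) * u y := by
      rw [rpow_sub_one huy.ne', div_mul_cancel₀ _ huy.ne']
    have h2 : v y ^ (p - 1) < u y ^ (p - 1) := rpow_lt_rpow hvy.le hlt (by linarith)
    rw [h1, ← sub_mul]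
    exact mul_pos (sub_pos.2 h2) huy
  have hg0 := hgpos x0 hx0G hx0
  set w0 := u x0 - v x0 with hw0def
  have hw0 : 0 < w0 := sub_pos.2 hx0
  have hnG : G ∈ nhds x0 := hGo.mem_nhds hx0G
  have hncl : closure G ∈ nhds x0 := Filter.mem_of_superset hnG hGsub
  have hev : ∀ᶠ y in nhds x0, y ∈ G ∧ g x0 / 2 < g y ∧ w0 / 2 < u y - v y := by
    have e1 : ∀ᶠ y in nhds x0, g x0 / 2 < g y :=
      (hgc.continuousAt hncl).eventually (lt_mem_nhds (by linarith))
    have e2 : ∀ᶠ y in nhds x0, w0 / 2 < u y - v y :=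
      (hwc.continuousAt hncl).eventually (lt_mem_nhds (by
        show w0 / 2 < w0
        linarith))
    filter_upwards [hnG, e1, e2] with y a b c using ⟨a, b, c⟩
  obtain ⟨r, hr, hball⟩ := Metric.eventually_nhds_iff_ball.1 hev
  -- measures
  have hGfin : volume G ≠ ⊤ := ((measure_mono hGsub).trans_lt hGc.measure_lt_top).ne
  have hBpos : 0 < volume.real (ball x0 r) :=
    ENNReal.toReal_pos (measure_ball_pos volume x0 hr).ne' measure_ball_lt_top.ne
  set c1 := g x0 / 2 * (w0 / 4) with hc1
  have hc1pos : 0 < c1 := by positivity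
  obtain ⟨ε, hε, hε1, hε2⟩ : ∃ ε : ℝ, 0 < ε ∧ ε ≤ w0 / 8 ∧
      C * (4 * ε * M) * volume.real G < c1 * volume.real (ball x0 r) := by
    set A := C * (4 * M) * volume.real G with hA
    have hA0 : 0 ≤ A := by positivity
    set B := c1 * volume.real (ball x0 r) with hB
    have hB0 : 0 < B := by positivity
    refine ⟨min (w0 / 8) (B / (2 * (A + 1))), by positivity, min_le_left _ _, ?_⟩
    have h1 : min (w0 / 8) (B / (2 * (A + 1))) * A ≤ B / (2 * (A + 1)) * A :=
      mul_le_mul_of_nonneg_right (min_le_right _ _) hA0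
    have h2 : B / (2 * (A + 1)) * A < B := by
      rw [div_mul_eq_mul_div, div_lt_iff₀ (by positivity)]
      nlinarith
    calc _ = min (w0 / 8) (B / (2 * (A + 1))) * A := by rw [hA]; ring
      _ < B := by linarith
  obtain ⟨κ, θ, Ψ, hκ, hθ, hΨ, hz, hpos⟩ := exists_trunc ε hε
  -- the compact set carrying the vector field
  set K := closure G ∩ (fun y => u y - v y) ⁻¹' (Ici ε) with hK
  have hKcl : IsClosed K := hwc.preimage_isClosed_of_isClosed isClosed_closure isClosed_Ici
  have hKc : IsCompact K := hGc.of_isClosed_subset hKcl inter_subset_left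
  have hKG : K ⊆ G := by
    rintro y ⟨hy1, hy2⟩
    by_contra hyG
    have : y ∈ frontier G := by
      rw [hGo.frontier_eq]; exact ⟨hy1, hyG⟩
    have h := hbd y this
    have h2 : ε ≤ u y - v y := hy2
    linarith
  set X : Fin N → EuclideanSpace ℝ (Fin N) → ℝ :=
    fun i => G.indicator (vf θ Ψ u v (EuclideanSpace.single i 1)) with hX
  have hXz : ∀ i, ∀ y, y ∉ K → X i y = 0 := by
    intro i y hy
    by_cases hyG : y ∈ G
    · have : u y - v y ≤ ε := by
        by_contra h
        exact hy ⟨hGsub hyG, (not_le.1 h).le⟩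
      simp [hX, hyG, vf, (hz _ this).1, (hz _ this).2]
    · simp [hX, hyG]
  have hXe0 : ∀ i, ∀ y, y ∉ K → X i =ᶠ[nhds y] fun _ => 0 := fun i y hy => by
    filter_upwards [hKcl.isOpen_compl.mem_nhds hy] with z hz using hXz i z hz
  have hXe : ∀ i, ∀ y ∈ G, X i =ᶠ[nhds y] vf θ Ψ u v (EuclideanSpace.single i 1) :=
    fun i y hy => by
      filter_upwards [hGo.mem_nhds hy] with z hz using indicator_of_mem hz _
  have hu2 : ∀ y ∈ G, ContDiffAt ℝ 2 u y := fun y hy => huC.contDiffAt (hGo.mem_nhds hy)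
  have hv2 : ∀ y ∈ G, ContDiffAt ℝ 2 v y := fun y hy => hvC.contDiffAt (hGo.mem_nhds hy)
  have hXC : ∀ i, ContDiff ℝ 1 (X i) := fun i => contDiff_iff_contDiffAt.2 fun y => by
    by_cases hy : y ∈ K
    · have hyG := hKG hy
      exact (vf_contDiffAt hκ hθ hΨ (hu2 y hyG) (hv2 y hyG) (hv0 y hyG) _).congr_of_eventuallyEq
        (hXe i y hyG)
    · exact contDiffAt_const.congr_of_eventuallyEq (hXe0 i y hy)
  have hXs : ∀ i, HasCompactSupport (X i) := fun i => HasCompactSupport.intro hKc (hXz i)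
  -- pointwise bound on the divergence
  have hpt : ∀ y, ∑ i, fderiv ℝ (X i) y (EuclideanSpace.single i 1) ≤
      G.indicator (fun _ => C * (4 * ε * M)) y - (ball x0 r).indicator (fun _ => c1) y := by
    intro y
    by_cases hy : y ∈ K
    · have hyG := hKG hy
      have hycl := hGsub hyG
      have hvy := hv0 y hyG
      have hwε : ε ≤ u y - v y := hy.2
      obtain ⟨t1, t2, t3, p1, p2, p3⟩ := hpos _ (hε.le.trans hwε)
      have s1 : ∑ i, fderiv ℝ (X i) y (EuclideanSpace.single i 1) ≤
          θ (u y - v y) ^ 2 * (v y)⁻¹ * lap v y - Ψ (u y - v y) * (lap u y - lap v y) := by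
        unfold lap
        rw [← Finset.sum_sub_distrib, Finset.mul_sum, Finset.mul_sum, ← Finset.sum_sub_distrib]
        refine Finset.sum_le_sum fun i _ => ?_
        rw [(hXe i y hyG).fderiv_eq]
        exact vf_fderiv hθ hΨ (hu2 y hyG) (hv2 y hyG) hvy _
      have s2 := alg_ineq (θ := θ (u y - v y)) hvy (hds0 y hycl) p1 (huI y hyG) (hvI y hyG)
      rw [← rpow_sub_one hvy.ne'] at s2
      have s3 := hC y hycl
      have s4 := hM y hycl
      rw [Real.norm_eq_abs] at s3 s4
      have s5 : u y - v y ≤ M := (le_abs_self _).trans s4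
      have hgy := hgpos y hyG (by linarith)
      set w := u y - v y with hw
      have s6 : |w * Ψ w - θ w ^ 2| ≤ 4 * ε * M := by
        have hwpos : 0 < w := hε.trans_le hwε
        have hwM : ε * w ≤ ε * M := mul_le_mul_of_nonneg_left s5 hε.le
        have q1 : w * Ψ w ≤ w * w := mul_le_mul_of_nonneg_left p2 hwpos.le
        have q2 : w * (w - 2 * ε) ≤ w * Ψ w := mul_le_mul_of_nonneg_left p3 hwpos.le
        have q3 : θ w ^ 2 ≤ w ^ 2 := pow_le_pow_left₀ t1 t2 2
        have q4 : w * (w - 4 * ε) ≤ θ w ^ 2 := by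
          rcases le_total w (2 * ε) with h | h
          · nlinarith [sq_nonneg (θ w)]
          · have := pow_le_pow_left₀ (by linarith : 0 ≤ w - 2 * ε) t3 2
            nlinarith [sq_nonneg ε]
        rw [abs_le]
        constructor <;> nlinarith
      have s7 : (μ / bdist Ω y ^ 2 - v y ^ (p - 1) / bdist Ω y ^ s) * (w * Ψ w - θ w ^ 2)
          ≤ C * (4 * ε * M) := by
        refine (le_abs_self _).trans ?_
        rw [abs_mul]
        exact mul_le_mul s3 s6 (abs_nonneg _) hC0
      have s8 : (ball x0 r).indicator (fun _ => c1) y ≤ g y * Ψ w := by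
        by_cases hyB : y ∈ ball x0 r
        · obtain ⟨_, b1, b2⟩ := hball y hyB
          rw [indicator_of_mem hyB, hc1]
          exact mul_le_mul b1.le (by linarith) (by positivity) hgy.le
        · rw [indicator_of_notMem hyB]
          positivity
      rw [indicator_of_mem hyG]
      have s9 : (u y ^ p - v y ^ (p - 1) * u y) / bdist Ω y ^ s * Ψ w = g y * Ψ w := rfl
      linarith
    · have l0 : ∑ i, fderiv ℝ (X i) y (EuclideanSpace.single i 1) = 0 :=
        Finset.sum_eq_zero fun i _ => by rw [(hXe0 i y hy).fderiv_eq]; simp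
      have hyB : y ∉ ball x0 r := fun hyB => by
        obtain ⟨b0, _, b2⟩ := hball y hyB
        refine hy ⟨hGsub b0, ?_⟩
        show ε ≤ u y - v y
        linarith
      rw [l0, indicator_of_notMem hyB, sub_zero]
      exact indicator_nonneg (fun _ _ => by positivity) y
  -- integrate
  have hI := fun i => int_fderiv_zero (X i) (hXC i) (hXs i) (EuclideanSpace.single i 1)
  have hint0 : ∫ y, ∑ i, fderiv ℝ (X i) y (EuclideanSpace.single i 1) = 0 := by
    rw [integral_finsetSum _ fun i _ => (hI i).1]
    exact Finset.sum_eq_zero fun i _ => (hI i).2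
  have hi1 : Integrable (G.indicator fun _ : EuclideanSpace ℝ (Fin N) => C * (4 * ε * M)) :=
    (integrable_indicator_iff hGo.measurableSet).2 (integrableOn_const hGfin)
  have hi2 : Integrable ((ball x0 r).indicator fun _ : EuclideanSpace ℝ (Fin N) => c1) :=
    (integrable_indicator_iff measurableSet_ball).2 (integrableOn_const measure_ball_lt_top.ne)
  have hle := integral_mono (integrable_finsetSum _ fun i _ => (hI i).1) (hi1.sub hi2) hpt
  rw [hint0, integral_sub' hi1 hi2, integral_indicator_const _ hGo.measurableSet,
    integral_indicator_const _ measurableSet_ball, smul_eq_mul, smul_eq_mul] at hle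
  linarith
end
end

section
/- Let μ ≤ 1/4, p > 1 and s ≥ β₋(p − 1) + 2. Then there exists ρ > 0 such that for every ε ∈ (0, ρ) there exist ρ_ε ∈ (0, ε) and a super-solution z_ε of (*) on the ring-shaped domain Ω_{ρ_ε,ρ}, continuous up to Γ_ρ, satisfying: z_ε > 0 on Ω_{ρ_ε,ρ}, z_ε = 0 on Γ_ρ, z_ε(x) → +∞ as δ(x) → ρ_ε from above (liminf_{δ(x)→ρ_ε⁺} z_ε(x) = +∞), and sup_{x ∈ Ω_{ε,ρ}} z_ε(x) ≤ ε. -/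
open Set Metric MeasureTheory Real

noncomputable section

lemma psi_exists (κ : ℝ) (hκ : 0 ≤ κ) : ∃ (ψ ψ1 ψ2 : ℝ → ℝ) (ν c C : ℝ), 0 < ν ∧ 0 < c ∧ 0 < C ∧
    ContDiff ℝ 2 ψ ∧ (∀ y, HasDerivAt ψ (ψ1 y) y) ∧ (∀ y, HasDerivAt ψ1 (ψ2 y) y) ∧ ψ 0 = 0 ∧
    (∀ y, 0 < y → 0 < ψ y) ∧ (∀ y, 0 < y → ψ y ≤ C) ∧ (∀ y, 0 < y → |ψ1 y| ≤ C) ∧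
    (∀ y, 1 ≤ y → c ≤ ψ y) ∧
    ∀ y, 0 < y → ψ2 y + 2 * κ * ψ1 y ≤ - (2 * ν * Real.exp (-y)) := by
  obtain ⟨b, hb0, hb1, hb⟩ : ∃ b : ℝ, 0 < b ∧ b ≤ 1 ∧ b ≠ 2 * κ := by
    by_cases h : (1:ℝ) = 2 * κ
    · exact ⟨1/2, by norm_num, by norm_num, by rw [← h]; norm_num⟩
    · exact ⟨1, by norm_num, le_rfl, h⟩
  obtain ⟨e, he, hec⟩ : ∃ e : ℝ, |e| ≤ 1/2 ∧ 0 < e * (2 * κ - b) := by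
    rcases lt_or_gt_of_ne hb with h | h
    · exact ⟨1/2, by norm_num [abs_of_pos], by nlinarith⟩
    · exact ⟨-1/2, by norm_num [abs_of_neg], by nlinarith⟩
  obtain ⟨he1, he2⟩ := abs_le.1 he
  set a := 2 * κ + 1 with ha
  have hder : ∀ r y : ℝ, HasDerivAt (fun y => Real.exp (-(r * y))) (-r * Real.exp (-(r * y))) y := by
    intro r y
    have h1 : HasDerivAt (fun y : ℝ => -(r * y)) (-(r * 1)) y := ((hasDerivAt_id y).const_mul r).neg
    convert h1.exp using 1
    ring
  have hE1 : ∀ r y : ℝ, 0 < r → 0 < y → Real.exp (-(r * y)) ≤ 1 := by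
    intro r y hr hy
    rw [Real.exp_le_one_iff]
    nlinarith [mul_pos hr hy]
  have hlow : ∀ y, 0 < y → (1/2) * (1 - Real.exp (-(a * y))) ≤
      1 + e * Real.exp (-(b * y)) - (1 + e) * Real.exp (-(a * y)) := by
    intro y hy
    have h1 : Real.exp (-(a * y)) ≤ Real.exp (-(b * y)) := by
      apply Real.exp_le_exp.2; nlinarith
    have h2 := hE1 b y hb0 hy
    nlinarith [mul_nonneg (by linarith : 0 ≤ e + 1/2) (by linarith : 0 ≤ Real.exp (-(b * y)) - Real.exp (-(a * y)))]
  refine ⟨fun y => 1 + e * Real.exp (-(b * y)) - (1 + e) * Real.exp (-(a * y)),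
    fun y => e * (-b * Real.exp (-(b * y))) - (1 + e) * (-a * Real.exp (-(a * y))),
    fun y => e * (-b * (-b * Real.exp (-(b * y)))) - (1 + e) * (-a * (-a * Real.exp (-(a * y)))),
    e * (2 * κ - b) * b / 2, (1/2) * (1 - Real.exp (-(a * 1))), 2 * a + 2, by positivity, ?_, by positivity,
    by fun_prop, ?_, ?_, by simp, ?_, ?_, ?_, ?_, ?_⟩
  · have : Real.exp (-(a * 1)) < 1 := by rw [Real.exp_lt_one_iff]; linarith
    linarith
  · intro y
    exact (((hder b y).const_mul e).const_add 1).sub ((hder a y).const_mul (1 + e))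
  · intro y
    exact (((hder b y).const_mul (-b)).const_mul e).sub (((hder a y).const_mul (-a)).const_mul (1 + e))
  · intro y hy
    have : Real.exp (-(a * y)) < 1 := by
      rw [Real.exp_lt_one_iff]
      have : 0 < a * y := by positivity
      linarith
    have := hlow y hy
    simp only
    linarith
  · intro y hy
    have h1 := hE1 b y hb0 hy
    have h2 := Real.exp_pos (-(b * y))
    have h3 := Real.exp_pos (-(a * y))
    have h4 : 0 < (1 + e) * Real.exp (-(a * y)) := mul_pos (by linarith) h3
    simp only
    nlinarith
  · intro y hy
    have h1 := hE1 b y hb0 hy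
    have h1' := hE1 a y (by linarith) hy
    have h2 := Real.exp_pos (-(b * y))
    have h3 := Real.exp_pos (-(a * y))
    have k1 : |e * (-b * Real.exp (-(b * y)))| ≤ (1/2) * (1 * 1) := by
      rw [abs_mul, abs_mul, abs_neg, abs_of_pos hb0, abs_of_pos h2]
      gcongr
    have k2 : |(1 + e) * (-a * Real.exp (-(a * y)))| ≤ (3/2) * (a * 1) := by
      rw [abs_mul, abs_mul, abs_neg, abs_of_pos (by linarith : 0 < a), abs_of_pos h3, abs_of_pos (by linarith : 0 < 1 + e)]
      gcongr
      linarith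
    have := abs_sub (e * (-b * Real.exp (-(b * y)))) ((1 + e) * (-a * Real.exp (-(a * y))))
    simp only
    linarith
  · intro y hy
    have := hlow y (by linarith)
    have h1 : Real.exp (-(a * y)) ≤ Real.exp (-(a * 1)) := by
      apply Real.exp_le_exp.2; nlinarith
    simp only
    linarith
  · intro y hy
    have h1 : Real.exp (-y) ≤ Real.exp (-(b * y)) := by
      apply Real.exp_le_exp.2; nlinarith
    have h3 := Real.exp_pos (-(a * y))
    have h4 : 0 ≤ (1 + e) * a * Real.exp (-(a * y)) :=
      mul_nonneg (mul_nonneg (by linarith) (by linarith)) h3.le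
    have h5 : 0 < e * (2 * κ - b) * b := by positivity
    have h6 := mul_le_mul_of_nonneg_left h1 h5.le
    simp only
    have h7 : e * (-b * (-b * Real.exp (-(b * y)))) - (1 + e) * (-a * (-a * Real.exp (-(a * y))))
      + 2 * κ * (e * (-b * Real.exp (-(b * y))) - (1 + e) * (-a * Real.exp (-(a * y))))
      = - (e * (2 * κ - b) * b * Real.exp (-(b * y))) - (a - 2 * κ) * ((1 + e) * a * Real.exp (-(a * y))) := by ring
    have h8 : a - 2 * κ = 1 := by rw [ha]; ring
    rw [h7, h8]
    linarith

lemma main_alg {κ B M p C q ρ R k k1 k2 W ψ ψ1 ψ2 E ν D : ℝ} (hκ : 0 ≤ κ) (hB : 0 ≤ B) (hM : 0 ≤ M)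
    (_ : 1 ≤ p) (hC : 0 < C) (hq0 : 0 < q) (hρ : 0 < ρ) (hR0 : 0 < R) (hkp : 0 < k) (b10 : 0 ≤ k1)
    (b20 : 0 ≤ k2) (hW0 : 0 < W) (b1 : k1 ≤ (q / R) * W) (b2 : k2 ≤ (q * (q + 1) / R) * W)
    (hψp : 0 < ψ) (hψc' : ψ ≤ C) (hψ1' : ψ1 ≤ C) (hEp : 0 < E) (hE1 : E ≤ 1)
    (hρν : M * ρ * ((B + 1) * C) ≤ ν) (hL : ψ2 + 2 * κ * ψ1 ≤ -(2 * ν * E))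
    (habs : |ψ1 * k + ψ * k1| ≤ C * k + C * k1)
    (hD : D = (2 * C + 2 * κ * C + M * ρ * C) * q + C * (q * (q + 1))) :
    ((ψ2 * k + ψ1 * k1) + (ψ1 * k1 + ψ * k2)) + 2 * κ * (ψ1 * k + ψ * k1) + M * ρ * E *
          (B * (ψ * k) + |ψ1 * k + ψ * k1|) ≤ - (ν * E) * k + (D / R) * W := by
  have i1 : (ψ2 + 2 * κ * ψ1) * k ≤ - (2 * ν * E) * k :=
    mul_le_mul_of_nonneg_right hL hkp.le
  have i2 : M * ρ * E * (B * (ψ * k) + |ψ1 * k + ψ * k1|) ≤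
      M * ρ * E * (B * (C * k) + (C * k + C * k1)) := by
    gcongr
  have i3 : M * ρ * ((B + 1) * C) * (E * k) ≤ ν * (E * k) :=
    mul_le_mul_of_nonneg_right hρν (by positivity)
  have i4 : M * ρ * E * (C * k1) ≤ M * ρ * 1 * (C * k1) := by
    gcongr
  have i5 : ψ1 * k1 ≤ C * k1 := mul_le_mul_of_nonneg_right hψ1' b10
  have i6 : κ * (ψ * k1) ≤ κ * (C * k1) := by gcongr
  have i7 : ψ * k2 ≤ C * k2 := by gcongr
  have i8 : (2 * C + 2 * κ * C + M * ρ * C) * k1 ≤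
    (2 * C + 2 * κ * C + M * ρ * C) * ((q / R) * W) := by gcongr
  have i9 : C * k2 ≤ C * ((q * (q + 1) / R) * W) := by gcongr
  have i10 : (D / R) * W = (2 * C + 2 * κ * C + M * ρ * C) * ((q / R) * W) +
      C * ((q * (q + 1) / R) * W) := by rw [hD]; ring
  rw [i10]
  linarith

set_option maxHeartbeats 1000000 in
lemma g_exists (κ B M p : ℝ) (hκ : 0 ≤ κ) (hB : 0 ≤ B) (hM : 0 ≤ M) (hp : 1 < p) :
    ∃ ρ1 : ℝ, 0 < ρ1 ∧ ∀ ρ, 0 < ρ → ρ ≤ ρ1 → ∀ Y ε : ℝ, 0 < ε → ∃ R : ℝ, 0 < R ∧ Y < R ∧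
    ∃ g g1 g2 : ℝ → ℝ, ContDiffOn ℝ 2 g (Iio R) ∧
      (∀ y < R, HasDerivAt g (g1 y) y) ∧ (∀ y < R, HasDerivAt g1 (g2 y) y) ∧ g 0 = 0 ∧
      (∀ y, 0 < y → y < R → 0 < g y) ∧
      (∀ m : ℝ, ∃ r, 0 < r ∧ r < R ∧ ∀ y, r < y → y < R → m ≤ g y) ∧
      (∀ y, 0 < y → y < Y → g y ≤ ε) ∧
      ∀ y, 0 < y → y < R →
        g2 y + 2 * κ * g1 y + M * ρ * Real.exp (-y) * (B * g y + |g1 y|) ≤ g y ^ p := by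
  obtain ⟨ψ, ψ1, ψ2, ν, c, C, hν, hc, hC, hψs, hd1, hd2, hψ0, hψpos, hψC, hψ1C, hψc, hL⟩ :=
    psi_exists κ hκ
  refine ⟨ν / (M * (B + 1) * C + 1), by positivity, ?_⟩
  intro ρ hρ hρ1 Y ε hε
  have hρν : M * ρ * ((B + 1) * C) ≤ ν := by
    rw [le_div_iff₀ (by positivity)] at hρ1
    nlinarith
  set q := 2 / (p - 1) with hq
  have hp1 : 0 < p - 1 := by linarith
  have hq0 : 0 < q := by positivity
  set η := ε / (C * 2 ^ q) with hη
  have hη0 : 0 < η := by positivity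
  set D := (2 * C + 2 * κ * C + M * ρ * C) * q + C * (q * (q + 1)) with hD
  have hD0 : 0 < D := by positivity
  obtain ⟨R, hR⟩ : ∃ R : ℝ, 2 ≤ R ∧ 2 * Y ≤ R ∧ Y < R ∧ D / (c ^ p * η ^ (p - 1)) ≤ R ∧
      4 * D / (ν * Real.exp (-1)) ≤ R :=
    ((Filter.eventually_ge_atTop 2).and ((Filter.eventually_ge_atTop (2 * Y)).and
      ((Filter.eventually_gt_atTop Y).and ((Filter.eventually_ge_atTop _).and
        (Filter.eventually_ge_atTop _))))).exists
  obtain ⟨hR2, hRY, hYR, hR3, hR4⟩ := hR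
  have hR0 : 0 < R := by linarith
  rw [div_le_iff₀ (by positivity)] at hR3 hR4
  have hX : ∀ y < R, 0 < 1 - y / R := by
    intro y hy
    have : y / R < 1 := (div_lt_one hR0).2 hy
    linarith
  have hdk : ∀ r y, y < R → HasDerivAt (fun y => (1 - y / R) ^ r) (-(r / R) * (1 - y / R) ^ (r - 1)) y := by
    intro r y hy
    have h1 : HasDerivAt (fun y : ℝ => 1 - y / R) (-(1 / R)) y :=
      ((hasDerivAt_id y).div_const R).const_sub 1
    convert h1.rpow_const (p := r) (Or.inl (hX y hy).ne') using 1
    ring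
  set k : ℝ → ℝ := fun y => η * (1 - y / R) ^ (-q) with hk
  set k1 : ℝ → ℝ := fun y => η * (-(-q / R) * (1 - y / R) ^ (-q - 1)) with hk1
  set k2 : ℝ → ℝ := fun y => η * (-(-q / R) * (-((-q - 1) / R) * (1 - y / R) ^ (-q - 1 - 1))) with hk2
  have hdk1 : ∀ y < R, HasDerivAt k (k1 y) y := fun y hy => (hdk _ y hy).const_mul η
  have hdk2 : ∀ y < R, HasDerivAt k1 (k2 y) y := fun y hy => ((hdk _ y hy).const_mul _).const_mul η
  have hkpos : ∀ y < R, 0 < k y := fun y hy => mul_pos hη0 (Real.rpow_pos_of_pos (hX y hy) _)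
  refine ⟨R, hR0, hYR, fun y => ψ y * k y, fun y => ψ1 y * k y + ψ y * k1 y,
    fun y => (ψ2 y * k y + ψ1 y * k1 y) + (ψ1 y * k1 y + ψ y * k2 y), ?_, ?_, ?_, ?_, ?_, ?_, ?_, ?_⟩
  · refine hψs.contDiffOn.mul (contDiffOn_const.mul ?_)
    refine ContDiffOn.rpow_const_of_ne ?_ (fun y hy => (hX y hy).ne')
    fun_prop
  · exact fun y hy => (hd1 y).mul (hdk1 y hy)
  · exact fun y hy => ((hd2 y).mul (hdk1 y hy)).add ((hd1 y).mul (hdk2 y hy))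
  · simp [hψ0]
  · exact fun y h0 hy => mul_pos (hψpos y h0) (hkpos y hy)
  · intro m
    -- blow up
    have hm : ∃ X0 : ℝ, 0 < X0 ∧ X0 < 1/2 ∧ ∀ X, 0 < X → X < X0 → m / (c * η) ≤ X ^ (-q) := by
      have h1 := (tendsto_rpow_neg_nhdsGT_zero (neg_neg_of_pos hq0)).eventually_ge_atTop (m / (c * η))
      rw [eventually_nhdsWithin_iff, Metric.eventually_nhds_iff] at h1
      obtain ⟨r, hr, h⟩ := h1
      refine ⟨min r (1/4), by positivity, lt_of_le_of_lt (min_le_right _ _) (by norm_num), ?_⟩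
      intro X hX0 hXr
      refine h ?_ hX0
      rw [Real.dist_eq, sub_zero, abs_of_pos hX0]
      exact lt_of_lt_of_le hXr (min_le_left _ _)
    obtain ⟨X0, hX00, hX01, hX0⟩ := hm
    refine ⟨R * (1 - X0), by nlinarith, by nlinarith, ?_⟩
    intro y hy1 hy2
    have h1 : 1 - y / R < X0 := by
      have : (1 - X0) < y / R := by rw [lt_div_iff₀ hR0]; linarith
      linarith
    have h2 := hX0 _ (hX y hy2) h1
    have h3 := hψc y (by nlinarith)
    rw [div_le_iff₀ (by positivity)] at h2
    have h4 := mul_le_mul_of_nonneg_right h3 (hkpos y hy2).le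
    simp only [hk] at h4 ⊢
    nlinarith
  · intro y h0 hy
    have h1 : 1/2 ≤ 1 - y / R := by
      have : y / R ≤ 1/2 := by rw [div_le_iff₀ hR0]; linarith
      linarith
    have h2 : (1 - y / R) ^ (-q) ≤ 2 ^ q := by
      calc (1 - y / R) ^ (-q) ≤ (1/2 : ℝ) ^ (-q) :=
            Real.rpow_le_rpow_of_nonpos (by norm_num) h1 (by linarith)
        _ = 2 ^ q := by
            rw [one_div, Real.inv_rpow (by norm_num), Real.rpow_neg (by norm_num), inv_inv]
    calc ψ y * k y ≤ C * (η * 2 ^ q) :=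
          mul_le_mul (hψC y h0) (mul_le_mul_of_nonneg_left h2 hη0.le) (hkpos y (by linarith)).le hC.le
      _ = ε := by rw [hη]; field_simp
  · intro y h0 hy
    have hXp := hX y hy
    set X := 1 - y / R with hXdef
    have hX1 : X ≤ 1 := by
      have : 0 < y / R := by positivity
      linarith
    have hkp := hkpos y hy
    have e1 : k1 y = (q / R) * (X⁻¹ * k y) := by
      simp only [hk1, hk, ← hXdef]
      rw [Real.rpow_sub_one hXp.ne']
      field_simp
    have e2 : k2 y = (q * (q + 1) / R ^ 2) * (X⁻¹ ^ 2 * k y) := by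
      simp only [hk2, hk, ← hXdef]
      rw [Real.rpow_sub_one hXp.ne', Real.rpow_sub_one hXp.ne']
      field_simp
      ring
    have hXi : 1 ≤ X⁻¹ := (one_le_inv₀ hXp).2 hX1
    set W := X⁻¹ ^ 2 * k y with hW
    have hW0 : 0 < W := by positivity
    have b1 : k1 y ≤ (q / R) * W := by
      rw [e1, hW]
      gcongr
      nlinarith
    have b10 : 0 ≤ k1 y := by rw [e1]; positivity
    have b20 : 0 ≤ k2 y := by rw [e2]; positivity
    have b2 : k2 y ≤ (q * (q + 1) / R) * W := by
      rw [e2]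
      gcongr
      nlinarith
    have hψp := hψpos y h0
    have hψc' := hψC y h0
    have hψ1 := hψ1C y h0
    have hψ1' := (abs_le.1 hψ1).2
    have hEp := Real.exp_pos (-y)
    have hE1 : Real.exp (-y) ≤ 1 := Real.exp_le_one_iff.2 (by linarith)
    have habs : |ψ1 y * k y + ψ y * k1 y| ≤ C * k y + C * k1 y := by
      refine (abs_add_le _ _).trans ?_
      rw [abs_mul (ψ1 y), abs_mul (ψ y), abs_of_pos hkp, abs_of_nonneg b10, abs_of_pos hψp]
      gcongr
    have main : ((ψ2 y * k y + ψ1 y * k1 y) + (ψ1 y * k1 y + ψ y * k2 y)) +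
        2 * κ * (ψ1 y * k y + ψ y * k1 y) + M * ρ * Real.exp (-y) *
          (B * (ψ y * k y) + |ψ1 y * k y + ψ y * k1 y|)
        ≤ - (ν * Real.exp (-y)) * k y + (D / R) * W := by
      exact main_alg hκ hB hM hp.le hC hq0 hρ hR0 hkp b10 b20 hW0 b1 b2 hψp hψc' hψ1' hEp hE1 hρν (hL y h0) habs hD
    refine main.trans ?_
    have hgp : (ψ y * k y) ^ p = ψ y ^ p * (η ^ (p - 1) * W) := by
      rw [Real.mul_rpow hψp.le hkp.le]
      congr 1
      have h1 : k y ^ p = k y ^ (p - 1) * k y := by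
        rw [Real.rpow_sub_one hkp.ne']; field_simp
      rw [h1, hW, ← mul_assoc (η ^ (p - 1))]
      refine congrArg (fun w => w * k y) ?_
      simp only [hk, ← hXdef]
      rw [Real.mul_rpow hη0.le (by positivity), ← Real.rpow_mul hXp.le]
      congr 1
      have : -q * (p - 1) = -(2:ℕ) := by rw [hq]; push_cast; field_simp
      rw [this, Real.rpow_neg hXp.le, Real.rpow_natCast, inv_pow]
    show _ ≤ (ψ y * k y) ^ p
    rw [hgp]
    rcases le_or_gt 1 y with h1 | h1
    · have j1 : D / R ≤ c ^ p * η ^ (p - 1) := by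
        rw [div_le_iff₀ hR0]; linarith
      have j2 : c ^ p ≤ ψ y ^ p := Real.rpow_le_rpow hc.le (hψc y h1) (by linarith)
      have j3 : (D / R) * W ≤ ψ y ^ p * η ^ (p - 1) * W := by
        refine mul_le_mul_of_nonneg_right (j1.trans ?_) hW0.le
        gcongr
      have j4 : 0 ≤ ν * Real.exp (-y) * k y := by positivity
      linarith
    · have hX2 : X⁻¹ ≤ 2 := by
        have : (1/2 : ℝ) ≤ X := by
          have : y / R ≤ 1/2 := by rw [div_le_iff₀ hR0]; linarith
          rw [hXdef]; linarith
        rw [inv_le_comm₀ hXp (by norm_num)]; linarith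
      have hW4 : W ≤ 4 * k y := by
        rw [hW]; gcongr; nlinarith
      have j1 : D / R * 4 ≤ ν * Real.exp (-1) := by
        rw [div_mul_eq_mul_div, div_le_iff₀ hR0]; linarith
      have j2 : Real.exp (-1) ≤ Real.exp (-y) := Real.exp_le_exp.2 (by linarith)
      have j3 : D / R * W ≤ D / R * (4 * k y) := by gcongr
      have j4 : D / R * 4 * k y ≤ ν * Real.exp (-y) * k y := by
        refine mul_le_mul_of_nonneg_right (j1.trans ?_) hkp.le
        gcongr
      have j5 : 0 ≤ ψ y ^ p * (η ^ (p - 1) * W) := by positivity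
      linarith

set_option maxHeartbeats 1000000 in
lemma f_exists (μ s p M ρ₀ : ℝ) (hμ : μ ≤ 1 / 4) (hp : 1 < p) (hM : 0 ≤ M) (hρ₀ : 0 < ρ₀)
    (hs : (1 / 2 - Real.sqrt (1 / 4 - μ)) * (p - 1) + 2 ≤ s) :
    ∃ ρ, 0 < ρ ∧ ρ < ρ₀ ∧ ∀ ε, 0 < ε → ε < ρ → ∃ ρε, 0 < ρε ∧ ρε < ε ∧ ∃ f f1 f2 : ℝ → ℝ,
      ContDiffOn ℝ 2 f (Ioi ρε) ∧ (∀ t > ρε, HasDerivAt f (f1 t) t) ∧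
      (∀ t > ρε, HasDerivAt f1 (f2 t) t) ∧ f ρ = 0 ∧
      (∀ t, ρε < t → t < ρ → 0 < f t) ∧
      (∀ m : ℝ, ∃ τ, ρε < τ ∧ τ < ρ ∧ ∀ t, ρε < t → t < τ → m ≤ f t) ∧
      (∀ t, ε < t → t < ρ → f t ≤ ε) ∧
      ∀ t, ρε < t → t < ρ → ∀ L, |L| ≤ M →
        0 ≤ -(f2 t + f1 t * L) - μ / t ^ 2 * f t + f t ^ p / t ^ s := by
  set κ := Real.sqrt (1 / 4 - μ) with hκ
  have hκ0 : 0 ≤ κ := Real.sqrt_nonneg _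
  have hκ2 : κ ^ 2 = 1 / 4 - μ := Real.sq_sqrt (by linarith)
  set β := 1 / 2 - κ with hβ
  obtain ⟨ρ1, hρ1, H⟩ := g_exists κ |β| M p hκ0 (abs_nonneg _) hM hp
  set ρ := min ρ1 (min (ρ₀ / 2) 1) with hρdef
  have hρ : 0 < ρ := by positivity
  have hρle : ρ ≤ 1 := (min_le_right _ _).trans (min_le_right _ _)
  have hρlt : ρ < ρ₀ := lt_of_le_of_lt ((min_le_right _ _).trans (min_le_left _ _)) (by linarith)
  refine ⟨ρ, hρ, hρlt, ?_⟩
  intro ε hε hερ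
  have hpowbd : ∀ a t : ℝ, 0 < a → a < t → t < ρ → min (a ^ β) (ρ ^ β) ≤ t ^ β ∧
      t ^ β ≤ max (a ^ β) (ρ ^ β) := by
    intro a t ha hat htρ
    rcases le_total 0 β with h | h
    · exact ⟨(min_le_left _ _).trans (Real.rpow_le_rpow ha.le hat.le h),
        (Real.rpow_le_rpow (by linarith) htρ.le h).trans (le_max_right _ _)⟩
    · exact ⟨(min_le_right _ _).trans (Real.rpow_le_rpow_of_nonpos (by linarith) htρ.le h),
        (Real.rpow_le_rpow_of_nonpos ha hat.le h).trans (le_max_left _ _)⟩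
  set A := max (ε ^ β) (ρ ^ β) with hA
  have hA0 : 0 < A := lt_max_of_lt_left (by positivity)
  obtain ⟨R, hR0, hYR, g, g1, g2, hgs, hg1, hg2, hg0, hgpos, hgblow, hgε, hgine⟩ :=
    H ρ hρ (min_le_left _ _) (Real.log ρ - Real.log ε) (ε / A) (by positivity)
  set y : ℝ → ℝ := fun t => Real.log ρ - Real.log t with hy
  set ρε := ρ * Real.exp (-R) with hρε
  have hρε0 : 0 < ρε := by positivity
  have hlogρε : Real.log ρε = Real.log ρ - R := by
    rw [hρε, Real.log_mul hρ.ne' (Real.exp_pos _).ne', Real.log_exp]; ring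
  have hyR : ∀ t, ρε < t → y t < R := by
    intro t ht
    have := Real.log_lt_log hρε0 ht
    simp only [hy]; linarith
  have hy0 : ∀ t, 0 < t → t < ρ → 0 < y t := by
    intro t h0 ht
    have := Real.log_lt_log h0 ht
    simp only [hy]; linarith
  have hρεε : ρε < ε := by
    rw [← Real.log_lt_log_iff hρε0 hε]; linarith
  have hdy : ∀ t, 0 < t → HasDerivAt y (-t⁻¹) t := fun t ht =>
    (Real.hasDerivAt_log ht.ne').const_sub _
  have hdp : ∀ r t : ℝ, 0 < t → HasDerivAt (fun t => t ^ r) (r * t ^ (r - 1)) t := fun r t ht =>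
    Real.hasDerivAt_rpow_const (Or.inl ht.ne')
  have hdg : ∀ t, ρε < t → HasDerivAt (fun t => g (y t)) (g1 (y t) * (-t⁻¹)) t := fun t ht =>
    (hg1 _ (hyR t ht)).comp t (hdy t (hρε0.trans ht))
  have hdg1 : ∀ t, ρε < t → HasDerivAt (fun t => g1 (y t)) (g2 (y t) * (-t⁻¹)) t := fun t ht =>
    (hg2 _ (hyR t ht)).comp t (hdy t (hρε0.trans ht))
  refine ⟨ρε, hρε0, hρεε, fun t => t ^ β * g (y t), 
    fun t => t ^ (β - 1) * (β * g (y t) - g1 (y t)),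
    fun t => t ^ (β - 1 - 1) * ((β - 1) * (β * g (y t) - g1 (y t)) - (β * g1 (y t) - g2 (y t))),
    ?_, ?_, ?_, ?_, ?_, ?_, ?_, ?_⟩
  · refine ContDiffOn.mul ?_ (hgs.comp ?_ (fun t ht => hyR t ht))
    · exact ContDiffOn.rpow_const_of_ne contDiffOn_id (fun t ht => (hρε0.trans ht).ne')
    · exact contDiffOn_const.sub (contDiffOn_id.log (fun t ht => (hρε0.trans ht).ne'))
  · intro t ht
    have ht0 : 0 < t := hρε0.trans ht
    refine ((hdp β t ht0).mul (hdg t ht)).congr_deriv ?_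
    have e : t ^ β = t ^ (β - 1) * t := by
      rw [Real.rpow_sub_one ht0.ne']; field_simp
    rw [e]
    field_simp
    ring
  · intro t ht
    have ht0 : 0 < t := hρε0.trans ht
    have h1 : HasDerivAt (fun t => β * g (y t) - g1 (y t))
      (β * (g1 (y t) * (-t⁻¹)) - g2 (y t) * (-t⁻¹)) t := ((hdg t ht).const_mul β).sub (hdg1 t ht)
    refine ((hdp (β - 1) t ht0).mul h1).congr_deriv ?_
    have e : t ^ (β - 1) = t ^ (β - 1 - 1) * t := by
      rw [Real.rpow_sub_one ht0.ne' (β - 1)]; field_simp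
    rw [e]
    field_simp
    ring
  · simp [hy, hg0]
  · intro t ht htρ
    have ht0 : 0 < t := hρε0.trans ht
    exact mul_pos (by positivity) (hgpos _ (hy0 t ht0 htρ) (hyR t ht))
  · intro m
    set a := min (ρε ^ β) (ρ ^ β) with ha
    have ha0 : 0 < a := lt_min (by positivity) (by positivity)
    obtain ⟨r, hr0, hrR, hr⟩ := hgblow (m / a)
    have hlt : ρ * Real.exp (-r) < ρ := by
      have : Real.exp (-r) < 1 := by rw [Real.exp_lt_one_iff]; linarith
      nlinarith
    refine ⟨ρ * Real.exp (-r), ?_, hlt, ?_⟩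
    · rw [hρε]; gcongr
    · intro t ht htr
      have ht0 : 0 < t := hρε0.trans ht
      have h1 : r < y t := by
        have := Real.log_lt_log ht0 htr
        rw [Real.log_mul hρ.ne' (Real.exp_pos _).ne', Real.log_exp] at this
        simp only [hy]; linarith
      have h2 := hr _ h1 (hyR t ht)
      rw [div_le_iff₀ ha0] at h2
      have h3 := (hpowbd ρε t hρε0 ht (htr.trans hlt)).1
      have h4 := hgpos _ (hr0.trans h1) (hyR t ht)
      have := mul_le_mul_of_nonneg_right h3 h4.le
      simp only
      linarith
  · intro t ht htρ
    have ht0 : 0 < t := hε.trans ht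
    have h1 : y t < Real.log ρ - Real.log ε := by
      have := Real.log_lt_log hε ht
      simp only [hy]; linarith
    have h2 := hgε _ (hy0 t ht0 htρ) h1
    have h3 := hgpos _ (hy0 t ht0 htρ) (h1.trans hYR)
    calc t ^ β * g (y t) ≤ A * (ε / A) :=
          mul_le_mul (hpowbd ε t hε ht htρ).2 h2 h3.le hA0.le
      _ = ε := by field_simp
  · intro t ht htρ L hL
    have ht0 : 0 < t := hρε0.trans ht
    have hyp := hy0 t ht0 htρ
    have hyr := hyR t ht
    have hG := hgpos _ hyp hyr
    have hI := hgine _ hyp hyr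
    have hexp : ρ * Real.exp (-(y t)) = t := by
      simp only [hy]
      rw [neg_sub, Real.exp_sub, Real.exp_log ht0, Real.exp_log hρ]
      field_simp
    rw [mul_assoc M, hexp] at hI
    simp only
    generalize g (y t) = G at *
    generalize g1 (y t) = G1 at *
    generalize g2 (y t) = G2 at *
    set P := t ^ (β - 1 - 1) with hP
    have hP0 : 0 < P := by positivity
    have e1 : t ^ (β - 1) = P * t := by
      rw [hP, Real.rpow_sub_one ht0.ne' (β - 1)]; field_simp
    have e2 : t ^ β = P * t ^ 2 := by
      rw [hP, Real.rpow_sub_one ht0.ne' (β - 1), Real.rpow_sub_one ht0.ne']; field_simp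
    have e3 : P * G ^ p ≤ (t ^ β * G) ^ p / t ^ s := by
      rw [Real.mul_rpow (by positivity) hG.le, mul_div_right_comm]
      refine mul_le_mul_of_nonneg_right ?_ (by positivity)
      rw [hP, ← Real.rpow_mul ht0.le, ← Real.rpow_sub ht0]
      apply Real.rpow_le_rpow_of_exponent_ge ht0 (by linarith)
      linarith
    have e4 : μ / t ^ 2 * (t ^ β * G) = P * (μ * G) := by
      rw [e2]; field_simp
    have e5 : (|β| * G + |G1|) * M ≥ (β * G - G1) * L := by
      have h1 : |β * G - G1| ≤ |β| * G + |G1| := by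
        refine (abs_sub _ _).trans ?_
        rw [abs_mul, abs_of_pos hG]
      calc (β * G - G1) * L ≤ |(β * G - G1) * L| := le_abs_self _
        _ = |β * G - G1| * |L| := abs_mul _ _
        _ ≤ _ := by gcongr
    have e6 := mul_le_mul_of_nonneg_left e5 ht0.le
    rw [e4, e1]
    have hμ' : μ = β * (1 - β) := by rw [hβ]; nlinarith
    have hκ' : 2 * κ = 1 - 2 * β := by rw [hβ]; ring
    rw [hκ'] at hI
    have e7 : 0 ≤ P * (-((β - 1) * (β * G - G1) - (β * G1 - G2)) - t * ((β * G - G1) * L) - μ * G + G ^ p) := by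
      apply mul_nonneg hP0.le
      rw [hμ']
      linarith
    linarith

lemma lap_comp {N : ℕ} (d : EuclideanSpace ℝ (Fin N) → ℝ) (G : Set (EuclideanSpace ℝ (Fin N)))
    (hG : IsOpen G) (hd : ContDiffOn ℝ 2 d G) (f f1 f2 : ℝ → ℝ) (a : ℝ)
    (hf1 : ∀ t > a, HasDerivAt f (f1 t) t) (hf2 : ∀ t > a, HasDerivAt f1 (f2 t) t)
    (hm : ∀ x ∈ G, a < d x) (x : EuclideanSpace ℝ (Fin N)) (hx : x ∈ G) :
    lap (fun y => f (d y)) x = f2 (d x) * ‖gradient d x‖ ^ 2 + f1 (d x) * lap d x := by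
  have hdd : ∀ y ∈ G, HasFDerivAt d (fderiv ℝ d y) y := fun y hy =>
    ((hd.contDiffAt (hG.mem_nhds hy)).differentiableAt (by norm_num)).hasFDerivAt
  have hdd2 : DifferentiableAt ℝ (fderiv ℝ d) x :=
    ((hd.contDiffAt (hG.mem_nhds hx)).fderiv_right (m := 1) (by norm_num)).differentiableAt (by norm_num)
  have hgrad : ‖gradient d x‖ ^ 2 =
      ∑ i : Fin N, (fderiv ℝ d x (EuclideanSpace.single i 1)) ^ 2 := by
    rw [EuclideanSpace.real_norm_sq_eq]
    refine Finset.sum_congr rfl fun i _ => ?_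
    congr 1
    rw [← toDual_gradient, InnerProductSpace.toDual_apply_apply, EuclideanSpace.inner_single_right]
    simp
  unfold lap
  rw [hgrad, Finset.mul_sum, Finset.mul_sum, ← Finset.sum_add_distrib]
  refine Finset.sum_congr rfl fun i _ => ?_
  set e : EuclideanSpace ℝ (Fin N) := EuclideanSpace.single i 1
  have hev : (fun y => fderiv ℝ (fun y => f (d y)) y e) =ᶠ[nhds x]
      fun y => f1 (d y) * fderiv ℝ d y e := by
    filter_upwards [hG.mem_nhds hx] with y hy
    have := ((hf1 _ (hm y hy)).comp_hasFDerivAt y (hdd y hy)).fderiv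
    change fderiv ℝ (f ∘ d) y e = _
    rw [this]
    simp
  rw [hev.fderiv_eq]
  have h1 : HasFDerivAt (fun y => f1 (d y)) (f2 (d x) • fderiv ℝ d x) x :=
    (hf2 _ (hm x hx)).comp_hasFDerivAt x (hdd x hx)
  have h2 : DifferentiableAt ℝ (fun y => fderiv ℝ d y e) x := hdd2.clm_apply (differentiableAt_const e)
  have h3 : HasFDerivAt (fun y => f1 (d y) * fderiv ℝ d y e) _ x := h1.mul h2.hasFDerivAt
  rw [h3.fderiv]
  simp
  ring

/-- Let `μ ≤ 1/4`, `p > 1` and `s ≥ β₋(p-1)+2`. Then there is `ρ > 0`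
such that for every `ε ∈ (0, ρ)` there are `ρ_ε ∈ (0, ε)` and a super-solution `z` of
`(*)` on the ring `Ω_{ρ_ε,ρ}`, continuous up to `Γ_ρ`, positive on the ring, vanishing on
`Γ_ρ`, blowing up as `δ(x) → ρ_ε⁺`, and with `z ≤ ε` on `Ω_{ε,ρ}`. -/
theorem stmt15 {N : ℕ} (hN : 2 ≤ N) (Ω : Set (EuclideanSpace ℝ (Fin N)))
    (hΩo : IsOpen Ω) (hΩne : Ω.Nonempty) (hΩb : Bornology.IsBounded Ω)
    (ρ₀ : ℝ) (hρ₀ : GoodCollar Ω ρ₀)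
    (μ s p : ℝ) (hμ : μ ≤ 1 / 4) (hp : 1 < p)
    (hs : (1 / 2 - Real.sqrt (1 / 4 - μ)) * (p - 1) + 2 ≤ s) :
    ∃ ρ, 0 < ρ ∧ ∀ ε, 0 < ε → ε < ρ →
      ∃ ρε, 0 < ρε ∧ ρε < ε ∧
        ∃ z : EuclideanSpace ℝ (Fin N) → ℝ,
          SuperSol Ω μ s p (ring' Ω ρε ρ) z ∧
          ContinuousOn z (ring' Ω ρε ρ ∪ {x ∈ Ω | bdist Ω x = ρ}) ∧
          (∀ x ∈ {x ∈ Ω | bdist Ω x = ρ}, z x = 0) ∧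
          (∀ M : ℝ, ∃ τ, ρε < τ ∧ τ < ρ ∧ ∀ x ∈ ring' Ω ρε τ, M ≤ z x) ∧
          (∀ x ∈ ring' Ω ε ρ, z x ≤ ε) := by

  obtain ⟨hρ₀0, hC2, hgrad, M, hM⟩ := hρ₀
  obtain ⟨ρ, hρ, hρlt, H⟩ := f_exists μ s p |M| ρ₀ hμ hp (abs_nonneg M) hρ₀0 hs
  refine ⟨ρ, hρ, fun ε hε hερ => ?_⟩
  obtain ⟨ρε, hρε, hρεε, f, f1, f2, hfs, hf1, hf2, hfρ, hfpos, hfblow, hfε, hfine⟩ := H ε hε hερ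
  have hcont : Continuous (bdist Ω) := Metric.continuous_infDist_pt _
  have hopen : IsOpen (ring' Ω ρε ρ) :=
    hΩo.inter ((isOpen_lt continuous_const hcont).inter (isOpen_lt hcont continuous_const))
  have hsub : ring' Ω ρε ρ ⊆ collar Ω ρ₀ := fun x hx => ⟨hx.1, hx.2.2.trans hρlt⟩
  have hC2' := hC2.mono hsub
  refine ⟨ρε, hρε, hρεε, fun x => f (bdist Ω x), ⟨?_, ?_, ?_⟩, ?_, ?_, ?_, ?_⟩
  · exact hfs.comp hC2' (fun x hx => hx.2.1)
  · exact fun x hx => hfpos _ hx.2.1 hx.2.2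
  · intro x hx
    rw [lap_comp (bdist Ω) _ hopen hC2' f f1 f2 ρε hf1 hf2 (fun x hx => hx.2.1) x hx,
      hgrad x (hsub hx), one_pow, mul_one]
    exact hfine _ hx.2.1 hx.2.2 _ ((hM x (hsub hx)).trans (le_abs_self M))
  · refine hfs.continuousOn.comp hcont.continuousOn ?_
    rintro x (hx | hx)
    · exact hx.2.1
    · have : bdist Ω x = ρ := hx.2
      show ρε < bdist Ω x
      linarith
  · intro x hx
    have : bdist Ω x = ρ := hx.2
    simp only [this, hfρ]
  · intro m
    obtain ⟨τ, h1, h2, h3⟩ := hfblow m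
    exact ⟨τ, h1, h2, fun x hx => h3 _ hx.2.1 hx.2.2⟩
  · exact fun x hx => hfε _ hx.2.1 hx.2.2
end
end

section
/- (Main theorem, nonexistence part.) Let μ ≤ 1/4, p > 1 and s ≥ β₋(p − 1) + 2. Then (*) admits no local L-subsolution: if u is a sub-solution of (*) on Ω_ρ for some ρ ∈ (0, ρ₀), then u, viewed as a local sub-harmonic of L_μ, is small, i.e. for every positive local super-harmonic h of L_μ one has limsup_{δ(x)→0} u(x)/h(x) < ∞. (Every sub-solution of (*) is automatically a sub-harmonic of L_μ since u^p/δ^s ≥ 0.) -/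
open Set Metric MeasureTheory Real

noncomputable section

/-- A local sub-harmonic `u` (defined on `Ω_ρ`) is *small* if
`limsup_{δ(x)→0} u(x)/h(x) < ∞` for every positive local super-harmonic `h` of `L_μ`. -/
def SmallSubHarm {N : ℕ} (Ω : Set (EuclideanSpace ℝ (Fin N))) (μ : ℝ)
    (u : EuclideanSpace ℝ (Fin N) → ℝ) (ρ : ℝ) : Prop :=
  ∀ σ, 0 < σ → ∀ h : EuclideanSpace ℝ (Fin N) → ℝ, PosSuperHarmOn Ω μ σ h →
    ∃ C : ℝ, ∃ τ, 0 < τ ∧ τ ≤ min ρ σ ∧ ∀ x ∈ collar Ω τ, u x / h x ≤ C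

/-- A local sub-harmonic `u` (defined on `Ω_ρ`) is *large* if
`limsup_{δ(x)→0} u(x)/h(x) > 0` for every positive local super-harmonic `h` of `L_μ`. -/
def LargeSubHarm {N : ℕ} (Ω : Set (EuclideanSpace ℝ (Fin N))) (μ : ℝ)
    (u : EuclideanSpace ℝ (Fin N) → ℝ) (ρ : ℝ) : Prop :=
  ∀ σ, 0 < σ → ∀ h : EuclideanSpace ℝ (Fin N) → ℝ, PosSuperHarmOn Ω μ σ h →
    ∃ c, 0 < c ∧ ∀ τ, 0 < τ → τ ≤ min ρ σ → ∃ x ∈ collar Ω τ, c ≤ u x / h x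

section aux
variable {N : ℕ}

theorem aux_diff {f : EuclideanSpace ℝ (Fin N) → ℝ} {x : EuclideanSpace ℝ (Fin N)}
    (hf : ContDiffAt ℝ 2 f x) (v : EuclideanSpace ℝ (Fin N)) :
    DifferentiableAt ℝ (fun y => fderiv ℝ f y v) x := by
  have h1 : ContDiffAt ℝ 1 (fderiv ℝ f) x := hf.fderiv_right (by norm_num)
  exact (h1.differentiableAt (by norm_num)).clm_apply (differentiableAt_const v)

theorem aux_ev {f : EuclideanSpace ℝ (Fin N) → ℝ} {x : EuclideanSpace ℝ (Fin N)}
    (hf : ContDiffAt ℝ 2 f x) : ∀ᶠ y in nhds x, DifferentiableAt ℝ f y := by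
  filter_upwards [hf.eventually (by simp)] with y hy
  exact hy.differentiableAt (by norm_num)

theorem lap_add' {f g : EuclideanSpace ℝ (Fin N) → ℝ} {x : EuclideanSpace ℝ (Fin N)}
    (hf : ContDiffAt ℝ 2 f x) (hg : ContDiffAt ℝ 2 g x) :
    lap (fun y => f y + g y) x = lap f x + lap g x := by
  unfold lap
  rw [← Finset.sum_add_distrib]
  refine Finset.sum_congr rfl fun i _ => ?_
  have : (fun y => fderiv ℝ (fun y => f y + g y) y (EuclideanSpace.single i 1)) =ᶠ[nhds x]
      fun y => fderiv ℝ f y (EuclideanSpace.single i 1) + fderiv ℝ g y (EuclideanSpace.single i 1) := by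
    filter_upwards [aux_ev hf, aux_ev hg] with y h1 h2
    rw [fderiv_fun_add h1 h2]; rfl
  rw [this.fderiv_eq, fderiv_fun_add (aux_diff hf _) (aux_diff hg _)]; rfl

theorem lap_smul' {f : EuclideanSpace ℝ (Fin N) → ℝ} {x : EuclideanSpace ℝ (Fin N)}
    (hf : ContDiffAt ℝ 2 f x) (c : ℝ) :
    lap (fun y => c * f y) x = c * lap f x := by
  unfold lap
  rw [Finset.mul_sum]
  refine Finset.sum_congr rfl fun i _ => ?_
  have : (fun y => fderiv ℝ (fun y => c * f y) y (EuclideanSpace.single i 1)) =ᶠ[nhds x]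
      fun y => c * fderiv ℝ f y (EuclideanSpace.single i 1) := by
    filter_upwards [aux_ev hf] with y h1
    rw [fderiv_const_mul h1]; rfl
  rw [this.fderiv_eq, fderiv_const_mul (aux_diff hf _)]; rfl

theorem lap_comp' {f : EuclideanSpace ℝ (Fin N) → ℝ} {x : EuclideanSpace ℝ (Fin N)}
    (hf : ContDiffAt ℝ 2 f x) {F F' : ℝ → ℝ} {F'' : ℝ}
    (h1 : ∀ᶠ t in nhds (f x), HasDerivAt F (F' t) t) (h2 : HasDerivAt F' F'' (f x)) :
    lap (fun y => F (f y)) x = F'' * ‖gradient f x‖ ^ 2 + F' (f x) * lap f x := by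
  have hn : ‖gradient f x‖ ^ 2 = ∑ i : Fin N, (fderiv ℝ f x (EuclideanSpace.single i 1)) ^ 2 := by
    rw [EuclideanSpace.norm_sq_eq]
    refine Finset.sum_congr rfl fun i _ => ?_
    have : fderiv ℝ f x (EuclideanSpace.single i 1) = (gradient f x) i := by
      have := InnerProductSpace.toDual_symm_apply (𝕜 := ℝ) (x := EuclideanSpace.single i (1:ℝ)) (y := fderiv ℝ f x)
      rw [← this, EuclideanSpace.inner_single_right]
      simp [gradient]
    rw [this, Real.norm_eq_abs, sq_abs]
  rw [hn]
  unfold lap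
  rw [Finset.mul_sum, Finset.mul_sum, ← Finset.sum_add_distrib]
  refine Finset.sum_congr rfl fun i _ => ?_
  have : (fun y => fderiv ℝ (fun y => F (f y)) y (EuclideanSpace.single i 1)) =ᶠ[nhds x]
      fun y => F' (f y) * fderiv ℝ f y (EuclideanSpace.single i 1) := by
    filter_upwards [aux_ev hf, hf.continuousAt.eventually h1] with y h3 h4
    have h5 := (h4.comp_hasFDerivAt y h3.hasFDerivAt).fderiv
    simp only [Function.comp_def] at h5
    rw [h5]; simp
  rw [this.fderiv_eq]
  have hx : DifferentiableAt ℝ f x := hf.differentiableAt (by norm_num)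
  have h5 := (h2.comp_hasFDerivAt x hx.hasFDerivAt).mul (aux_diff hf (EuclideanSpace.single i 1)).hasFDerivAt
  have h6 := h5.fderiv
  have h7 : (fun y => F' (f y) * fderiv ℝ f y (EuclideanSpace.single i 1)) = (F' ∘ f) * (fun y => fderiv ℝ f y (EuclideanSpace.single i 1)) := rfl
  rw [h7, h6]
  simp
  ring

theorem one_dim_max {g : ℝ → ℝ} (hd : ∀ᶠ t in nhds 0, DifferentiableAt ℝ g t)
    (hm : IsLocalMax g 0) : deriv (deriv g) 0 ≤ 0 := by
  by_contra! h
  have h0 : deriv g 0 = 0 := hm.deriv_eq_zero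
  have hmin := isLocalMin_of_deriv_deriv_pos h h0 hd.self_of_nhds.continuousAt
  have hc : g =ᶠ[nhds 0] fun _ => g 0 := by
    filter_upwards [hm, hmin] with t h1 h2 using le_antisymm h1 h2
  have := hc.deriv.deriv_eq
  simp at this
  linarith

theorem lap_nonpos {f : EuclideanSpace ℝ (Fin N) → ℝ} {x : EuclideanSpace ℝ (Fin N)}
    (hf : ContDiffAt ℝ 2 f x) (hm : IsLocalMax f x) : lap f x ≤ 0 := by
  unfold lap
  refine Finset.sum_nonpos fun i _ => ?_
  set e : EuclideanSpace ℝ (Fin N) := EuclideanSpace.single i 1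
  have hl : ∀ t : ℝ, HasDerivAt (fun t : ℝ => x + t • e) e t := fun t => by
    simpa using ((hasDerivAt_id t).smul_const e).const_add x
  have hx0 : x + (0:ℝ) • e = x := by simp
  have hc : Filter.Tendsto (fun t : ℝ => x + t • e) (nhds 0) (nhds x) := by
    have := (hl 0).continuousAt.tendsto
    rwa [hx0] at this
  have hev := hc.eventually (aux_ev hf)
  have hd : ∀ᶠ t in nhds (0:ℝ), HasDerivAt (fun t : ℝ => f (x + t • e)) (fderiv ℝ f (x + t • e) e) t := by
    filter_upwards [hev] with t ht
    exact ht.hasFDerivAt.comp_hasDerivAt t (hl t)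
  have h1 := one_dim_max (g := fun t : ℝ => f (x + t • e)) (hd.mono fun t h => h.differentiableAt)
    (by
      have : ∀ᶠ t in nhds (0:ℝ), f (x + t • e) ≤ f x := hc.eventually hm
      filter_upwards [this] with t ht
      simpa using ht)
  have h2 : deriv (fun t : ℝ => f (x + t • e)) =ᶠ[nhds 0] fun t => fderiv ℝ f (x + t • e) e := by
    filter_upwards [hd] with t ht using ht.deriv
  rw [h2.deriv_eq] at h1
  have h3 := (aux_diff hf e).hasFDerivAt
  have h4 : HasFDerivAt (fun y => fderiv ℝ f y e) (fderiv ℝ (fun y => fderiv ℝ f y e) x) (x + (0:ℝ) • e) := by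
    rw [hx0]; exact h3
  have h5 := (h4.comp_hasDerivAt (0:ℝ) (hl 0)).deriv
  simp only [Function.comp_def] at h5
  rw [h5] at h1
  exact h1

end aux

section aux1

theorem g_bound {a p x : ℝ} (ha : 0 < a) (hp : 1 < p) (hap : a * (p - 1) = 1) (hx : 0 < x) :
    |-a * x ^ (-a - 1) + -(2 * a) * x ^ (-(2 * a) - 1)| +
      |-a * ((-a - 1) * x ^ (-a - 2)) + -(2 * a) * ((-(2 * a) - 1) * x ^ (-(2 * a) - 2))| ≤
    (3 * a + a * (a + 1) + 2 * a * (2 * a + 1)) * (x ^ (-a) + x ^ (-(2 * a))) ^ p := by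
  set Q := (x ^ (-a) + x ^ (-(2 * a))) ^ p with hQ
  have key : ∀ e : ℝ, -(2 * a + 2) ≤ e → e ≤ -(a + 1) → x ^ e ≤ Q := by
    intro e h1 h2
    have p1 : 0 < x ^ (-a) := rpow_pos_of_pos hx _
    have p2 : 0 < x ^ (-(2 * a)) := rpow_pos_of_pos hx _
    rcases le_total 1 x with h | h
    · calc x ^ e ≤ x ^ (-(a + 1)) := rpow_le_rpow_of_exponent_le h h2
        _ = (x ^ (-a)) ^ p := by rw [← rpow_mul hx.le]; congr 1; linarith
        _ ≤ Q := rpow_le_rpow p1.le (by linarith) (by linarith)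
    · calc x ^ e ≤ x ^ (-(2 * a + 2)) := rpow_le_rpow_of_exponent_ge hx h h1
        _ = (x ^ (-(2 * a))) ^ p := by rw [← rpow_mul hx.le]; congr 1; linarith
        _ ≤ Q := rpow_le_rpow p2.le (by linarith) (by linarith)
  have k1 := key (-a - 1) (by linarith) (by linarith)
  have k2 := key (-(2 * a) - 1) (by linarith) (by linarith)
  have k3 := key (-a - 2) (by linarith) (by linarith)
  have k4 := key (-(2 * a) - 2) (by linarith) (by linarith)
  have q1 : 0 < x ^ (-a - 1) := rpow_pos_of_pos hx _
  have q2 : 0 < x ^ (-(2 * a) - 1) := rpow_pos_of_pos hx _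
  have q3 : 0 < x ^ (-a - 2) := rpow_pos_of_pos hx _
  have q4 : 0 < x ^ (-(2 * a) - 2) := rpow_pos_of_pos hx _
  have e1 : |-a * x ^ (-a - 1) + -(2 * a) * x ^ (-(2 * a) - 1)| =
      a * x ^ (-a - 1) + 2 * a * x ^ (-(2 * a) - 1) := by
    rw [abs_of_nonpos]
    · ring
    · have := mul_pos ha q1
      have := mul_pos ha q2
      linarith
  have e2 : |-a * ((-a - 1) * x ^ (-a - 2)) + -(2 * a) * ((-(2 * a) - 1) * x ^ (-(2 * a) - 2))| =
      a * (a + 1) * x ^ (-a - 2) + 2 * a * (2 * a + 1) * x ^ (-(2 * a) - 2) := by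
    rw [abs_of_nonneg]
    · ring
    · have h1 : 0 ≤ a * (a + 1) * x ^ (-a - 2) := by positivity
      have h2 : 0 ≤ 2 * a * (2 * a + 1) * x ^ (-(2 * a) - 2) := by positivity
      linarith
  rw [e1, e2]
  have m1 := mul_le_mul_of_nonneg_left k1 ha.le
  have m2 := mul_le_mul_of_nonneg_left k2 (show 0 ≤ 2 * a by positivity)
  have m3 := mul_le_mul_of_nonneg_left k3 (show 0 ≤ a * (a + 1) by positivity)
  have m4 := mul_le_mul_of_nonneg_left k4 (show 0 ≤ 2 * a * (2 * a + 1) by positivity)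
  linarith

theorem barrier_ineq {t β φ φ1 φ2 D μ g G1 G2 k A B M p s : ℝ} (ht : 0 < t) (ht1 : t < 1)
    (hp : 1 < p) (hs : β * (p - 1) + 2 ≤ s) (hk : 0 < k) (hB : 0 ≤ B)
    (hg : 0 ≤ g)
    (hφl : t ^ β / 2 ≤ φ) (hφu : φ ≤ 2 * t ^ β) (hφ1 : |φ1| ≤ B * (t ^ β / t)) (hD : |D| ≤ M)
    (hsup : 0 ≤ -(φ2 + φ1 * D) - μ / t ^ 2 * φ)
    (hG : |G1| + |G2| ≤ A * g ^ p)
    (hkk : k * ((2 * B + 4 + 2 * M) * A) ≤ (k / 2) ^ p) :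
    0 ≤ -((φ2 * (k * g) + 2 * φ1 * (k * (G1 / t)) + φ * (k * ((G2 - G1) / t ^ 2))) +
      (φ1 * (k * g) + φ * (k * (G1 / t))) * D) - μ / t ^ 2 * (φ * (k * g)) +
      (φ * (k * g)) ^ p / t ^ s := by
  have hT : 0 < t ^ β := rpow_pos_of_pos ht _
  set T := t ^ β with hTdef
  have hM : 0 ≤ M := (abs_nonneg _).trans hD
  have hφ0 : 0 ≤ φ := by linarith
  have hgp : 0 ≤ g ^ p := rpow_nonneg hg _
  have htp : 0 < t ^ 2 := by positivity
  have L1 : (k / 2) ^ p * g ^ p * (T / t ^ 2) ≤ (φ * (k * g)) ^ p / t ^ s := by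
    have h1 : t ^ s ≤ t ^ (β * (p - 1) + 2) := rpow_le_rpow_of_exponent_ge ht ht1.le hs
    have h2 : (T * ((k / 2) * g)) ^ p ≤ (φ * (k * g)) ^ p := by
      apply rpow_le_rpow (by positivity) _ (by linarith)
      have := mul_le_mul_of_nonneg_right hφl (show 0 ≤ k * g by positivity)
      linarith
    have h3 : (k / 2) ^ p * g ^ p * (T / t ^ 2) = (T * ((k / 2) * g)) ^ p / t ^ (β * (p - 1) + 2) := by
      rw [mul_rpow hT.le (by positivity), mul_rpow (by positivity) hg, hTdef, ← rpow_mul ht.le,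
        rpow_add ht, rpow_two]
      have h4 : t ^ (β * p) = t ^ β * t ^ (β * (p - 1)) := by
        rw [← rpow_add ht]; congr 1; ring
      have h5 : 0 < t ^ (β * (p - 1)) := rpow_pos_of_pos ht _
      rw [h4]; field_simp
    rw [h3]
    have h6 : 0 < t ^ s := rpow_pos_of_pos ht _
    exact div_le_div₀ (by positivity) h2 h6 h1
  have L2 : 2 * φ1 * (G1 / t) + φ * ((G2 - G1) / t ^ 2) + φ * (G1 / t) * D ≤
      (T / t ^ 2) * ((2 * B + 4 + 2 * M) * (|G1| + |G2|)) := by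
    have hg1 := abs_nonneg G1
    have hg2 := abs_nonneg G2
    have b1 : 2 * φ1 * (G1 / t) ≤ (T / t ^ 2) * (2 * B * |G1|) := by
      calc 2 * φ1 * (G1 / t) ≤ |2 * φ1 * (G1 / t)| := le_abs_self _
        _ = 2 * |φ1| * (|G1| / t) := by rw [abs_mul, abs_mul, abs_div, abs_of_pos ht, abs_two]
        _ ≤ 2 * (B * (T / t)) * (|G1| / t) := by gcongr
        _ = _ := by field_simp
    have b2 : φ * ((G2 - G1) / t ^ 2) ≤ (T / t ^ 2) * (2 * (|G1| + |G2|)) := by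
      have : G2 - G1 ≤ |G1| + |G2| := by
        have := le_abs_self G2
        have := neg_abs_le G1
        linarith
      calc φ * ((G2 - G1) / t ^ 2) ≤ φ * ((|G1| + |G2|) / t ^ 2) := by gcongr
        _ ≤ (2 * T) * ((|G1| + |G2|) / t ^ 2) := by gcongr
        _ = _ := by ring
    have b3 : φ * (G1 / t) * D ≤ (T / t ^ 2) * (2 * M * |G1|) := by
      calc φ * (G1 / t) * D ≤ |φ * (G1 / t) * D| := le_abs_self _
        _ = φ * (|G1| / t) * |D| := by rw [abs_mul, abs_mul, abs_div, abs_of_pos ht, abs_of_nonneg hφ0]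
        _ ≤ (2 * T) * (|G1| / t) * M := by gcongr
        _ ≤ (2 * T) * (|G1| / t ^ 2) * M := by
            gcongr
            nlinarith
        _ = _ := by ring
    have hTt : 0 ≤ T / t ^ 2 := by positivity
    have : 2 * B * |G1| + 2 * (|G1| + |G2|) + 2 * M * |G1| ≤ (2 * B + 4 + 2 * M) * (|G1| + |G2|) := by
      have := mul_nonneg hB hg2
      have := mul_nonneg hM hg2
      nlinarith
    have := mul_le_mul_of_nonneg_left this hTt
    linarith
  have L3 : k * ((T / t ^ 2) * ((2 * B + 4 + 2 * M) * (|G1| + |G2|))) ≤ (k / 2) ^ p * g ^ p * (T / t ^ 2) := by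
    calc k * ((T / t ^ 2) * ((2 * B + 4 + 2 * M) * (|G1| + |G2|)))
        ≤ k * ((T / t ^ 2) * ((2 * B + 4 + 2 * M) * (A * g ^ p))) := by gcongr
      _ = (k * ((2 * B + 4 + 2 * M) * A)) * (g ^ p * (T / t ^ 2)) := by ring
      _ ≤ (k / 2) ^ p * (g ^ p * (T / t ^ 2)) := by gcongr
      _ = _ := by ring
  have L4 := mul_le_mul_of_nonneg_left L2 hk.le
  have L5 := mul_nonneg (mul_nonneg hk.le hg) hsup
  have : -((φ2 * (k * g) + 2 * φ1 * (k * (G1 / t)) + φ * (k * ((G2 - G1) / t ^ 2))) +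
      (φ1 * (k * g) + φ * (k * (G1 / t))) * D) - μ / t ^ 2 * (φ * (k * g)) =
      k * g * (-(φ2 + φ1 * D) - μ / t ^ 2 * φ) -
      k * (2 * φ1 * (G1 / t) + φ * ((G2 - G1) / t ^ 2) + φ * (G1 / t) * D) := by ring
  rw [this]
  linarith

theorem rpow_deriv (e : ℝ) {t : ℝ} (ht : 0 < t) :
    HasDerivAt (fun y : ℝ => y ^ e) (e * t ^ (e - 1)) t :=
  Real.hasDerivAt_rpow_const (Or.inl ht.ne')

theorem phi_exists (μ M : ℝ) (hμ : μ ≤ 1 / 4) (_hM : 0 ≤ M) :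
    ∃ (φ φ1 φ2 : ℝ → ℝ) (B τ : ℝ), 0 ≤ B ∧ 0 < τ ∧ τ < 1 ∧
      (∀ t, 0 < t → HasDerivAt φ (φ1 t) t ∧ HasDerivAt φ1 (φ2 t) t ∧ ContDiffAt ℝ 2 φ t) ∧
      (∀ t, 0 < t → t < 1 → t ^ (1 / 2 - √(1 / 4 - μ)) / 2 ≤ φ t ∧
        φ t ≤ 2 * t ^ (1 / 2 - √(1 / 4 - μ)) ∧ |φ1 t| ≤ B * (t ^ (1 / 2 - √(1 / 4 - μ)) / t)) ∧
      (∀ t, 0 < t → t < τ → ∀ D, |D| ≤ M → 0 ≤ -(φ2 t + φ1 t * D) - μ / t ^ 2 * φ t) := by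
  set q := √(1 / 4 - μ) with hq
  have hq0 : 0 ≤ q := Real.sqrt_nonneg _
  have hq2 : q ^ 2 = 1 / 4 - μ := Real.sq_sqrt (by linarith)
  set β := 1 / 2 - q with hβ
  have hβμ : β * (1 - β) = μ := by rw [hβ]; linarith
  obtain ⟨κ, ε, hκ, hε0, hε1, hc⟩ : ∃ κ ε : ℝ, |κ| ≤ 1 / 2 ∧ 0 < ε ∧ ε < 1 ∧
      0 < κ * (ε * (2 * q) - ε ^ 2) := by
    rcases hq0.eq_or_lt with h | h
    · refine ⟨-1 / 2, 1 / 2, ?_, by norm_num, by norm_num, ?_⟩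
      · rw [abs_le]; constructor <;> norm_num
      · rw [← h]; norm_num
    · refine ⟨1 / 2, min (1 / 2) q, ?_, by positivity, ?_, ?_⟩
      · rw [abs_of_pos] <;> norm_num
      · exact (min_le_left _ _).trans_lt (by norm_num)
      · have h1 : 0 < min (1 / 2) q := by positivity
        have h2 : min (1 / 2) q ≤ q := min_le_right _ _
        have : 0 < min (1 / 2) q * (2 * q - min (1 / 2) q) := mul_pos h1 (by linarith)
        nlinarith
  set c0 := κ * (ε * (2 * q) - ε ^ 2) with hc0
  set B := |β| + |β + ε| with hB
  have hB0 : 0 ≤ B := by positivity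
  -- smallness of τ
  obtain ⟨τ, hτ0, hτ1, hτ⟩ : ∃ τ : ℝ, 0 < τ ∧ τ < 1 ∧ ∀ t, 0 < t → t < τ → M * B * t ^ (1 - ε) ≤ c0 := by
    have h1 : Filter.Tendsto (fun t : ℝ => M * B * t ^ (1 - ε)) (nhds 0) (nhds (M * B * 0 ^ (1 - ε))) := by
      apply Filter.Tendsto.const_mul
      exact (Real.continuousAt_rpow_const 0 (1 - ε) (Or.inr (by linarith))).tendsto
    rw [Real.zero_rpow (by linarith), mul_zero] at h1
    have h2 := h1.eventually (gt_mem_nhds hc)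
    obtain ⟨r, hr, hr2⟩ := Metric.eventually_nhds_iff.1 h2
    refine ⟨min r (1 / 2), by positivity, (min_le_right _ _).trans_lt (by norm_num), fun t h3 h4 => ?_⟩
    refine (hr2 ?_).le
    rw [Real.dist_eq, sub_zero, abs_of_pos h3]
    exact h4.trans_le (min_le_left _ _)
  have hb1 : ∀ t : ℝ, 0 < t → t ^ β / t = t ^ (β - 1) := fun t ht => by rw [rpow_sub_one ht.ne']
  refine ⟨fun t => t ^ β + κ * t ^ (β + ε), fun t => β * t ^ (β - 1) + κ * ((β + ε) * t ^ (β + ε - 1)),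
    fun t => β * ((β - 1) * t ^ (β - 1 - 1)) + κ * ((β + ε) * ((β + ε - 1) * t ^ (β + ε - 1 - 1))),
    B, τ, hB0, hτ0, hτ1, ?_, ?_, ?_⟩
  · intro t ht
    refine ⟨(rpow_deriv β ht).add ((rpow_deriv (β + ε) ht).const_mul κ),
      ((rpow_deriv (β - 1) ht).const_mul β).add
        (((rpow_deriv (β + ε - 1) ht).const_mul (β + ε)).const_mul κ), ?_⟩
    exact (contDiffAt_id.rpow_const_of_ne ht.ne').add
      (contDiffAt_const.mul (contDiffAt_id.rpow_const_of_ne ht.ne'))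
  · intro t ht ht1
    have hT : 0 < t ^ β := rpow_pos_of_pos ht _
    have hTε : 0 < t ^ (β + ε) := rpow_pos_of_pos ht _
    have hle : t ^ (β + ε) ≤ t ^ β := rpow_le_rpow_of_exponent_ge ht ht1.le (by linarith)
    have habs : |κ * t ^ (β + ε)| ≤ 1 / 2 * t ^ β := by
      rw [abs_mul, abs_of_pos hTε]; gcongr
    have := abs_le.1 habs
    refine ⟨by linarith, by linarith, ?_⟩
    have hT1 : 0 < t ^ (β - 1) := rpow_pos_of_pos ht _
    have hT2 : 0 < t ^ (β + ε - 1) := rpow_pos_of_pos ht _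
    have hle2 : t ^ (β + ε - 1) ≤ t ^ (β - 1) := rpow_le_rpow_of_exponent_ge ht ht1.le (by linarith)
    rw [hb1 t ht]
    calc |β * t ^ (β - 1) + κ * ((β + ε) * t ^ (β + ε - 1))|
        ≤ |β * t ^ (β - 1)| + |κ * ((β + ε) * t ^ (β + ε - 1))| := abs_add_le _ _
      _ = |β| * t ^ (β - 1) + |κ| * (|β + ε| * t ^ (β + ε - 1)) := by
          rw [abs_mul, abs_mul, abs_mul, abs_of_pos hT1, abs_of_pos hT2]
      _ ≤ |β| * t ^ (β - 1) + 1 * (|β + ε| * t ^ (β - 1)) := by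
          gcongr
          linarith
      _ = B * t ^ (β - 1) := by rw [hB]; ring
  · intro t ht htτ D hD
    have ht1 : t < 1 := htτ.trans hτ1
    have hT1 : 0 < t ^ (β - 1) := rpow_pos_of_pos ht _
    have hT2 : 0 < t ^ (β + ε - 1) := rpow_pos_of_pos ht _
    have hle2 : t ^ (β + ε - 1) ≤ t ^ (β - 1) := rpow_le_rpow_of_exponent_ge ht ht1.le (by linarith)
    have hφ1 : |β * t ^ (β - 1) + κ * ((β + ε) * t ^ (β + ε - 1))| ≤ B * t ^ (β - 1) := by
      calc |β * t ^ (β - 1) + κ * ((β + ε) * t ^ (β + ε - 1))|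
        ≤ |β * t ^ (β - 1)| + |κ * ((β + ε) * t ^ (β + ε - 1))| := abs_add_le _ _
      _ = |β| * t ^ (β - 1) + |κ| * (|β + ε| * t ^ (β + ε - 1)) := by
          rw [abs_mul, abs_mul, abs_mul, abs_of_pos hT1, abs_of_pos hT2]
      _ ≤ |β| * t ^ (β - 1) + 1 * (|β + ε| * t ^ (β - 1)) := by
          gcongr
          linarith
      _ = B * t ^ (β - 1) := by rw [hB]; ring
    have hprod : (β * t ^ (β - 1) + κ * ((β + ε) * t ^ (β + ε - 1))) * D ≤ M * B * t ^ (β - 1) := by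
      calc _ ≤ |(β * t ^ (β - 1) + κ * ((β + ε) * t ^ (β + ε - 1))) * D| := le_abs_self _
        _ ≤ (B * t ^ (β - 1)) * M := by rw [abs_mul]; gcongr
        _ = _ := by ring
    have hE : 0 < t ^ (β + ε - 2) := rpow_pos_of_pos ht _
    have h1 : M * B * t ^ (β - 1) ≤ c0 * t ^ (β + ε - 2) := by
      have := mul_le_mul_of_nonneg_right (hτ t ht htτ) hE.le
      have h2 : t ^ (β - 1) = t ^ (1 - ε) * t ^ (β + ε - 2) := by
        rw [← rpow_add ht]; congr 1; ring
      rw [h2]; linarith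
    have e1 : t ^ β = t ^ (β - 2) * t ^ 2 := by
      rw [← rpow_two, ← rpow_add ht]; congr 1; ring
    have e2 : t ^ (β + ε) = t ^ (β + ε - 2) * t ^ 2 := by
      rw [← rpow_two, ← rpow_add ht]; congr 1; ring
    have e3 : β - 1 - 1 = β - 2 := by ring
    have e4 : β + ε - 1 - 1 = β + ε - 2 := by ring
    have e5 : μ / t ^ 2 * (t ^ β + κ * t ^ (β + ε)) = μ * (t ^ (β - 2) + κ * t ^ (β + ε - 2)) := by
      rw [e1, e2]; field_simp
    simp only [e5, e3, e4]
    have hfin : -(β * ((β - 1) * t ^ (β - 2)) + κ * ((β + ε) * ((β + ε - 1) * t ^ (β + ε - 2)))) -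
        μ * (t ^ (β - 2) + κ * t ^ (β + ε - 2)) = c0 * t ^ (β + ε - 2) := by
      rw [← hβμ, hc0]
      have : 2 * q = 1 - 2 * β := by rw [hβ]; ring
      rw [this]; ring
    linarith

theorem barrier_exists (μ M p s : ℝ) (hμ : μ ≤ 1 / 4) (hM : 0 ≤ M) (hp : 1 < p)
    (hs : (1 / 2 - √(1 / 4 - μ)) * (p - 1) + 2 ≤ s) :
    ∃ (V V1 V2 : ℝ → ℝ → ℝ) (τ : ℝ), 0 < τ ∧ τ < 1 ∧
      (∀ η t, 0 < η → η < t → HasDerivAt (V η) (V1 η t) t ∧ HasDerivAt (V1 η) (V2 η t) t ∧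
        ContDiffAt ℝ 2 (V η) t) ∧
      (∀ η t, 0 < η → η < t → t < τ → 0 < V η t) ∧
      (∀ η t, 0 < η → η < t → t < τ → ∀ D, |D| ≤ M →
        0 ≤ -(V2 η t + V1 η t * D) - μ / t ^ 2 * V η t + V η t ^ p / t ^ s) ∧
      (∀ η, 0 < η → η < τ → Filter.Tendsto (V η) (nhdsWithin η (Ioi η)) Filter.atTop) ∧
      (∀ t, 0 < t → Filter.Tendsto (fun η => V η t) (nhdsWithin 0 (Ioi 0)) (nhds 0)) := by
  obtain ⟨φ, φ1, φ2, B, τ, hB, hτ0, hτ1, hφd, hφb, hφs⟩ := phi_exists μ M hμ hM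
  set β := 1 / 2 - √(1 / 4 - μ) with hβ
  set a := 1 / (p - 1) with ha'
  have hp1 : 0 < p - 1 := by linarith
  have ha : 0 < a := by positivity
  have hap : a * (p - 1) = 1 := by rw [ha']; field_simp
  set A := 3 * a + a * (a + 1) + 2 * a * (2 * a + 1) with hA
  have hA0 : 0 < A := by positivity
  obtain ⟨k, hk, hkk⟩ : ∃ k : ℝ, 0 < k ∧ k * ((2 * B + 4 + 2 * M) * A) ≤ (k / 2) ^ p := by
    set E := (2 * B + 4 + 2 * M) * A with hE
    have hE0 : 0 < E := by positivity
    refine ⟨2 * (2 * E) ^ a, by positivity, ?_⟩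
    have h1 : 2 * (2 * E) ^ a / 2 = (2 * E) ^ a := by ring
    have h2 : a * p = a + 1 := by linarith
    rw [h1, ← rpow_mul (by positivity), h2, rpow_add (by positivity), rpow_one]
    apply le_of_eq; ring
  set g : ℝ → ℝ := fun x => x ^ (-a) + x ^ (-(2 * a)) with hg
  set g1 : ℝ → ℝ := fun x => -a * x ^ (-a - 1) + -(2 * a) * x ^ (-(2 * a) - 1) with hg1
  set g2 : ℝ → ℝ := fun x => -a * ((-a - 1) * x ^ (-a - 2)) +
    -(2 * a) * ((-(2 * a) - 1) * x ^ (-(2 * a) - 2)) with hg2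
  have dg : ∀ x, 0 < x → HasDerivAt g (g1 x) x := fun x hx =>
    (rpow_deriv (-a) hx).add (rpow_deriv (-(2 * a)) hx)
  have dg1 : ∀ x, 0 < x → HasDerivAt g1 (g2 x) x := fun x hx => by
    have h1 := ((rpow_deriv (-a - 1) hx).const_mul (-a)).add
      ((rpow_deriv (-(2 * a) - 1) hx).const_mul (-(2 * a)))
    have e1 : -a - 1 - 1 = -a - 2 := by ring
    have e2 : -(2 * a) - 1 - 1 = -(2 * a) - 2 := by ring
    rw [e1, e2] at h1
    exact h1
  have hxpos : ∀ η t : ℝ, 0 < η → η < t → 0 < log t - log η := fun η t h1 h2 =>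
    sub_pos.2 (Real.log_lt_log h1 h2)
  have gpos : ∀ x, 0 < x → 0 < g x := fun x hx =>
    add_pos (rpow_pos_of_pos hx _) (rpow_pos_of_pos hx _)
  have dlog : ∀ η t : ℝ, 0 < t → HasDerivAt (fun t => log t - log η) (t⁻¹) t := fun η t ht =>
    (Real.hasDerivAt_log ht.ne').sub_const _
  refine ⟨fun η t => φ t * (k * g (log t - log η)),
    fun η t => φ1 t * (k * g (log t - log η)) + φ t * (k * (g1 (log t - log η) / t)),
    fun η t => φ2 t * (k * g (log t - log η)) + 2 * φ1 t * (k * (g1 (log t - log η) / t)) +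
      φ t * (k * ((g2 (log t - log η) - g1 (log t - log η)) / t ^ 2)), τ, hτ0, hτ1, ?_, ?_, ?_, ?_, ?_⟩
  · intro η t hη ht
    have ht0 : 0 < t := hη.trans ht
    have hx := hxpos η t hη ht
    obtain ⟨d1, d2, d3⟩ := hφd t ht0
    have k1 : HasDerivAt (fun t => g (log t - log η)) (g1 (log t - log η) * t⁻¹) t :=
      HasDerivAt.comp (h := fun t => log t - log η) (h₂ := g) t (dg _ hx) (dlog η t ht0)
    have k2 : HasDerivAt (fun t => g1 (log t - log η)) (g2 (log t - log η) * t⁻¹) t :=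
      HasDerivAt.comp (h := fun t => log t - log η) (h₂ := g1) t (dg1 _ hx) (dlog η t ht0)
    refine ⟨?_, ?_, ?_⟩
    · exact (d1.mul (k1.const_mul k)).congr_deriv (by ring)
    · have h := (d2.mul (k1.const_mul k)).add (d1.mul ((k2.div (hasDerivAt_id t) ht0.ne').const_mul k))
      refine h.congr_deriv ?_
      simp only [id, Pi.div_apply]
      field_simp
      ring
    · refine d3.mul (contDiffAt_const.mul ?_)
      have hl : ContDiffAt ℝ 2 (fun t => log t - log η) t :=
        (contDiffAt_id.log ht0.ne').sub contDiffAt_const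
      exact (hl.rpow_const_of_ne hx.ne').add (hl.rpow_const_of_ne hx.ne')
  · intro η t hη ht htτ
    have ht0 : 0 < t := hη.trans ht
    have := gpos _ (hxpos η t hη ht)
    have h1 := (hφb t ht0 (htτ.trans hτ1)).1
    have hT : 0 < t ^ β := rpow_pos_of_pos ht0 _
    have : 0 < φ t := by linarith
    positivity
  · intro η t hη ht htτ D hD
    have ht0 : 0 < t := hη.trans ht
    have hx := hxpos η t hη ht
    obtain ⟨b1, b2, b3⟩ := hφb t ht0 (htτ.trans hτ1)
    exact barrier_ineq ht0 (htτ.trans hτ1) hp hs hk hB (gpos _ hx).le b1 b2 b3 hD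
      (hφs t ht0 htτ D hD) (g_bound ha hp hap hx) hkk
  · intro η hη hητ
    have hT : 0 < η ^ β := rpow_pos_of_pos hη _
    have hφη : 0 < φ η := by linarith [(hφb η hη (hητ.trans hτ1)).1]
    have c1 : Filter.Tendsto φ (nhdsWithin η (Ioi η)) (nhds (φ η)) :=
      (hφd η hη).1.continuousAt.tendsto.mono_left nhdsWithin_le_nhds
    have c2 : Filter.Tendsto (fun t => log t - log η) (nhdsWithin η (Ioi η)) (nhdsWithin 0 (Ioi 0)) := by
      apply tendsto_nhdsWithin_of_tendsto_nhds_of_eventually_within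
      · have := (dlog η η hη).continuousAt.tendsto.mono_left (nhdsWithin_le_nhds (s := Ioi η))
        simpa using this
      · filter_upwards [self_mem_nhdsWithin] with t ht using hxpos η t hη ht
    have c3 : Filter.Tendsto g (nhdsWithin 0 (Ioi 0)) Filter.atTop :=
      (tendsto_rpow_neg_nhdsGT_zero (by linarith)).atTop_add_atTop
        (tendsto_rpow_neg_nhdsGT_zero (by linarith))
    exact c1.pos_mul_atTop hφη ((c3.comp c2).const_mul_atTop hk)
  · intro t ht
    have c1 : Filter.Tendsto (fun η => log t - log η) (nhdsWithin 0 (Ioi 0)) Filter.atTop := by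
      have := Filter.tendsto_neg_atBot_atTop.comp Real.tendsto_log_nhdsGT_zero
      simpa [sub_eq_add_neg] using Filter.tendsto_atTop_add_const_left _ (log t) this
    have c2 : Filter.Tendsto g Filter.atTop (nhds (0 + 0)) :=
      (tendsto_rpow_neg_atTop ha).add (tendsto_rpow_neg_atTop (by positivity))
    have := ((c2.comp c1).const_mul k).const_mul (φ t)
    simpa using this

end aux1

section aux2
variable {N : ℕ}

theorem collar_open {Ω : Set (EuclideanSpace ℝ (Fin N))} (hΩ : IsOpen Ω) (ρ : ℝ) :
    IsOpen (collar Ω ρ) :=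
  hΩ.inter (isOpen_lt (Metric.continuous_infDist_pt _) continuous_const)

theorem mem_of_bdist_pos {Ω : Set (EuclideanSpace ℝ (Fin N))} {x : EuclideanSpace ℝ (Fin N)}
    (h : 0 < bdist Ω x) : x ∈ Ω := by
  by_contra hx
  have : bdist Ω x = 0 := Metric.infDist_zero_of_mem hx
  linarith

theorem bdist_pos_of_mem {Ω : Set (EuclideanSpace ℝ (Fin N))} (hN : 2 ≤ N) (hΩ : IsOpen Ω)
    (hb : Bornology.IsBounded Ω) {x : EuclideanSpace ℝ (Fin N)} (h : x ∈ Ω) : 0 < bdist Ω x := by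
  have : Nonempty (Fin N) := ⟨⟨0, by omega⟩⟩
  have hne : (Ωᶜ).Nonempty := by
    by_contra hne
    rw [Set.not_nonempty_iff_eq_empty, Set.compl_empty_iff] at hne
    rw [hne] at hb
    exact NormedSpace.unbounded_univ ℝ (EuclideanSpace ℝ (Fin N)) hb
  exact (hΩ.isClosed_compl.notMem_iff_infDist_pos hne).1 (by simpa using h)

theorem band_compact {Ω : Set (EuclideanSpace ℝ (Fin N))} (hb : Bornology.IsBounded Ω)
    {a : ℝ} (ha : 0 < a) (b : ℝ) : IsCompact {x | a ≤ bdist Ω x ∧ bdist Ω x ≤ b} := by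
  apply Metric.isCompact_of_isClosed_isBounded
  · exact (isClosed_le continuous_const (Metric.continuous_infDist_pt _)).inter
      (isClosed_le (Metric.continuous_infDist_pt _) continuous_const)
  · exact hb.subset fun x hx => mem_of_bdist_pos (ha.trans_le hx.1)

/-- pointwise contradiction at an interior maximum of `u / (V + K h)`. -/
theorem max_contra {x : EuclideanSpace ℝ (Fin N)} {u V h : EuclideanSpace ℝ (Fin N) → ℝ}
    {m K q p S : ℝ} (hu : ContDiffAt ℝ 2 u x) (hV : ContDiffAt ℝ 2 V x) (hh : ContDiffAt ℝ 2 h x)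
    (hm : 1 < m) (hp : 1 < p) (hK : 0 ≤ K) (hS : 0 < S) (hVx : 0 < V x) (hhx : 0 < h x)
    (hux : u x = m * (V x + K * h x))
    (hmax : ∀ᶠ y in nhds x, u y ≤ m * (V y + K * h y))
    (hsub : -(lap u x) - q * u x + u x ^ p / S ≤ 0)
    (hsup : 0 ≤ -(lap V x) - q * V x + V x ^ p / S)
    (hsh : 0 ≤ -(lap h x) - q * h x) : False := by
  have hKh : ContDiffAt ℝ 2 (fun y => K * h y) x := contDiffAt_const.mul hh
  have hW : ContDiffAt ℝ 2 (fun y => V y + K * h y) x := hV.add hKh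
  have hmW : ContDiffAt ℝ 2 (fun y => (-m) * (V y + K * h y)) x := contDiffAt_const.mul hW
  have hl : lap (fun y => u y + (-m) * (V y + K * h y)) x ≤ 0 := by
    apply lap_nonpos (hu.add hmW)
    filter_upwards [hmax] with y hy
    rw [hux]; linarith
  rw [lap_add' hu hmW, lap_smul' hW, lap_add' hV hKh, lap_smul' hh] at hl
  have hup : m * V x ^ p < u x ^ p := by
    have h1 : 0 < V x ^ p := rpow_pos_of_pos hVx _
    have h2 : m < m ^ p := by
      simpa using rpow_lt_rpow_of_exponent_lt hm hp
    calc m * V x ^ p < m ^ p * V x ^ p := by gcongr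
      _ = (m * V x) ^ p := by rw [mul_rpow (by linarith) hVx.le]
      _ ≤ u x ^ p := by
        apply rpow_le_rpow (by positivity) _ (by linarith)
        rw [hux]
        have : 0 ≤ K * h x := by positivity
        gcongr
        linarith
  have h3 : m * (V x ^ p / S) < u x ^ p / S := by
    rw [← mul_div_assoc]; gcongr
  have h4 := mul_nonneg (show 0 ≤ m by linarith) hsup
  have h5 := mul_nonneg (mul_nonneg (show 0 ≤ m by linarith) hK) hsh
  rw [hux] at hsub
  rw [hux] at h3
  nlinarith

end aux2

/-- (Main theorem, nonexistence part.) Let `μ ≤ 1/4`, `p > 1` and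
`s ≥ β₋(p-1)+2`. Then `(*)` admits no local `L`-subsolution: every sub-solution of `(*)`
on a collar `Ω_ρ`, `ρ ∈ (0, ρ₀)`, is a *small* local sub-harmonic of `L_μ`, i.e. for
every positive local super-harmonic `h` of `L_μ`, `limsup_{δ(x)→0} u(x)/h(x) < ∞`. -/
theorem stmt16 {N : ℕ} (hN : 2 ≤ N) (Ω : Set (EuclideanSpace ℝ (Fin N)))
    (hΩo : IsOpen Ω) (hΩne : Ω.Nonempty) (hΩb : Bornology.IsBounded Ω)
    (ρ₀ : ℝ) (hρ₀ : GoodCollar Ω ρ₀)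
    (d : EuclideanSpace ℝ (Fin N) → ℝ) (c : ℝ) (hd : RegDist Ω d c)
    (μ s p : ℝ) (hμ : μ ≤ 1 / 4) (hp : 1 < p)
    (hs : (1 / 2 - Real.sqrt (1 / 4 - μ)) * (p - 1) + 2 ≤ s) :
    ∀ ρ, 0 < ρ → ρ < ρ₀ → ∀ u : EuclideanSpace ℝ (Fin N) → ℝ,
      SubSol Ω μ s p (collar Ω ρ) u → SmallSubHarm Ω μ u ρ := by
  intro ρ hρ hρρ u hu σ hσ h hh
  obtain ⟨hρ₀pos, hδC, hδg, M, hδl⟩ := hρ₀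
  obtain ⟨huC, hu0, hus⟩ := hu
  obtain ⟨⟨hhC, hhs⟩, hhp⟩ := hh
  obtain ⟨V, V1, V2, τ₁, hτ₁, hτ₁1, hVd, hVp, hVs, hVtop, hV0⟩ :=
    barrier_exists μ |M| p s hμ (abs_nonneg M) hp hs
  have hcont : Continuous (bdist Ω) := Metric.continuous_infDist_pt _
  set τ := min τ₁ (min ρ σ) / 2 with hτdef
  have hmin : 0 < min τ₁ (min ρ σ) := by positivity
  have hτ0 : 0 < τ := by positivity
  have hττ₁ : τ < τ₁ := by have := min_le_left τ₁ (min ρ σ); linarith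
  have hτm : τ < min ρ σ := by have := min_le_right τ₁ (min ρ σ); linarith
  have hτρ : τ < ρ := hτm.trans_le (min_le_left _ _)
  have hτσ : τ < σ := hτm.trans_le (min_le_right _ _)
  have inρ : ∀ y, 0 < bdist Ω y → bdist Ω y ≤ τ → y ∈ collar Ω ρ := fun y h1 h2 =>
    ⟨mem_of_bdist_pos h1, h2.trans_lt hτρ⟩
  have inσ : ∀ y, 0 < bdist Ω y → bdist Ω y ≤ τ → y ∈ collar Ω σ := fun y h1 h2 =>
    ⟨mem_of_bdist_pos h1, h2.trans_lt hτσ⟩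
  have inρ₀ : ∀ y, 0 < bdist Ω y → bdist Ω y ≤ τ → y ∈ collar Ω ρ₀ := fun y h1 h2 =>
    ⟨mem_of_bdist_pos h1, h2.trans_lt (hτρ.trans hρρ)⟩
  have uC : ∀ y, 0 < bdist Ω y → bdist Ω y ≤ τ → ContDiffAt ℝ 2 u y := fun y h1 h2 =>
    huC.contDiffAt ((collar_open hΩo ρ).mem_nhds (inρ y h1 h2))
  have hC : ∀ y, 0 < bdist Ω y → bdist Ω y ≤ τ → ContDiffAt ℝ 2 h y := fun y h1 h2 =>
    hhC.contDiffAt ((collar_open hΩo σ).mem_nhds (inσ y h1 h2))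
  have δC : ∀ y, 0 < bdist Ω y → bdist Ω y ≤ τ → ContDiffAt ℝ 2 (bdist Ω) y := fun y h1 h2 =>
    hδC.contDiffAt ((collar_open hΩo ρ₀).mem_nhds (inρ₀ y h1 h2))
  -- the constant on the inner boundary
  obtain ⟨K, hK0, hK⟩ : ∃ K : ℝ, 0 ≤ K ∧ ∀ y, bdist Ω y = τ → u y ≤ K * h y := by
    have hcpt := band_compact hΩb hτ0 τ
    have hco : ContinuousOn (fun y => u y / h y) {x | τ ≤ bdist Ω x ∧ bdist Ω x ≤ τ} := by
      intro y hy
      have h1 : 0 < bdist Ω y := hτ0.trans_le hy.1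
      exact ((uC y h1 hy.2).continuousAt.div (hC y h1 hy.2).continuousAt
        (hhp y (inσ y h1 hy.2)).ne').continuousWithinAt
    obtain ⟨C, hCb⟩ := hcpt.bddAbove_image hco
    refine ⟨max C 0, le_max_right _ _, fun y hy => ?_⟩
    have h1 : 0 < bdist Ω y := hy ▸ hτ0
    have h2 : u y / h y ≤ C := hCb ⟨y, ⟨hy.ge, hy.le⟩, rfl⟩
    have h3 := hhp y (inσ y h1 hy.le)
    rw [div_le_iff₀ h3] at h2
    exact h2.trans (by gcongr; exact le_max_left _ _)
  -- comparison
  have comp : ∀ η, 0 < η → ∀ x, η < bdist Ω x → bdist Ω x < τ →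
      u x ≤ V η (bdist Ω x) + K * h x := by
    intro η hη x hx1 hx2
    have hητ : η < τ := hx1.trans hx2
    obtain ⟨U, hU⟩ : ∃ U, ∀ y, η ≤ bdist Ω y → bdist Ω y ≤ τ → u y ≤ U := by
      have hco : ContinuousOn u {x | η ≤ bdist Ω x ∧ bdist Ω x ≤ τ} := fun y hy =>
        (uC y (hη.trans_le hy.1) hy.2).continuousAt.continuousWithinAt
      obtain ⟨U, hU⟩ := (band_compact hΩb hη τ).bddAbove_image hco
      exact ⟨U, fun y h1 h2 => hU ⟨y, ⟨h1, h2⟩, rfl⟩⟩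
    obtain ⟨η', ⟨hη'V, hη'x⟩, hη'⟩ : ∃ η', (U ≤ V η η' ∧ η' < bdist Ω x) ∧ η < η' := by
      have e1 := (hVtop η hη (hητ.trans hττ₁)).eventually_ge_atTop U
      have e2 : ∀ᶠ t in nhdsWithin η (Ioi η), t < bdist Ω x :=
        nhdsWithin_le_nhds (gt_mem_nhds hx1)
      exact ((e1.and e2).and self_mem_nhdsWithin).exists
    have hη'0 : 0 < η' := hη.trans hη'
    have posV : ∀ y, η' ≤ bdist Ω y → bdist Ω y ≤ τ → 0 < V η (bdist Ω y) := fun y h1 h2 =>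
      hVp η _ hη (hη'.trans_le h1) (h2.trans_lt hττ₁)
    have posh : ∀ y, η' ≤ bdist Ω y → bdist Ω y ≤ τ → 0 < h y := fun y h1 h2 =>
      hhp y (inσ y (hη'0.trans_le h1) h2)
    have posW : ∀ y, η' ≤ bdist Ω y → bdist Ω y ≤ τ → 0 < V η (bdist Ω y) + K * h y :=
      fun y h1 h2 => add_pos_of_pos_of_nonneg (posV y h1 h2) (mul_nonneg hK0 (posh y h1 h2).le)
    have VC : ∀ y, η' ≤ bdist Ω y → bdist Ω y ≤ τ →
        ContDiffAt ℝ 2 (fun y => V η (bdist Ω y)) y := fun y h1 h2 =>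
      ContDiffAt.comp y (hVd η _ hη (hη'.trans_le h1)).2.2 (δC y (hη'0.trans_le h1) h2)
    by_contra! hcon
    have hco : ContinuousOn (fun y => u y / (V η (bdist Ω y) + K * h y))
        {x | η' ≤ bdist Ω x ∧ bdist Ω x ≤ τ} := fun y hy =>
      ((uC y (hη'0.trans_le hy.1) hy.2).continuousAt.div
        ((VC y hy.1 hy.2).continuousAt.add
          (continuousAt_const.mul (hC y (hη'0.trans_le hy.1) hy.2).continuousAt))
        (posW y hy.1 hy.2).ne').continuousWithinAt
    obtain ⟨z, ⟨hz1, hz2⟩, hzmax⟩ := (band_compact hΩb hη'0 τ).exists_isMaxOn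
      ⟨x, hη'x.le, hx2.le⟩ hco
    set m := u z / (V η (bdist Ω z) + K * h z) with hm
    have hm1 : 1 < m := by
      have h1 : u x / (V η (bdist Ω x) + K * h x) ≤ m := hzmax ⟨hη'x.le, hx2.le⟩
      refine lt_of_lt_of_le ?_ h1
      rw [lt_div_iff₀ (posW x hη'x.le hx2.le)]
      linarith
    have huz : u z = m * (V η (bdist Ω z) + K * h z) := by
      rw [hm, div_mul_cancel₀ _ (posW z hz1 hz2).ne']
    have huz' : V η (bdist Ω z) + K * h z < u z := by
      have := posW z hz1 hz2
      rw [huz]; nlinarith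
    have hKh : 0 ≤ K * h z := mul_nonneg hK0 (posh z hz1 hz2).le
    have hz1' : η' < bdist Ω z := by
      refine lt_of_le_of_ne hz1 fun he => ?_
      have h1 := hU z (hη'.le.trans hz1) hz2
      rw [← he] at huz'
      linarith
    have hz2' : bdist Ω z < τ := by
      refine lt_of_le_of_ne hz2 fun he => ?_
      have h1 := hK z he
      have := posV z hz1 hz2
      linarith
    have hz0 : 0 < bdist Ω z := hη'0.trans hz1'
    have hev : ∀ᶠ y in nhds z, u y ≤ m * (V η (bdist Ω y) + K * h y) := by
      filter_upwards [hcont.continuousAt.eventually (lt_mem_nhds hz1'),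
        hcont.continuousAt.eventually (gt_mem_nhds hz2')] with y h1 h2
      have h3 : u y / (V η (bdist Ω y) + K * h y) ≤ m := hzmax ⟨h1.le, h2.le⟩
      rwa [div_le_iff₀ (posW y h1.le h2.le)] at h3
    have hlapV : lap (fun y => V η (bdist Ω y)) z =
        V2 η (bdist Ω z) + V1 η (bdist Ω z) * lap (bdist Ω) z := by
      have hηz : η < bdist Ω z := hη'.trans hz1'
      rw [lap_comp' (F := V η) (F' := V1 η) (δC z hz0 hz2)
        ((lt_mem_nhds hηz).mono fun t ht => (hVd η t hη ht).1) (hVd η _ hη hηz).2.1,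
        hδg z (inρ₀ z hz0 hz2)]
      ring
    have hsupV := hVs η (bdist Ω z) hη (hη'.trans hz1') (hz2.trans_lt hττ₁) (lap (bdist Ω) z)
      ((hδl z (inρ₀ z hz0 hz2)).trans (le_abs_self M))
    rw [← hlapV] at hsupV
    exact max_contra (V := fun y => V η (bdist Ω y)) (uC z hz0 hz2) (VC z hz1 hz2) (hC z hz0 hz2)
      hm1 hp hK0 (rpow_pos_of_pos hz0 s) (posV z hz1 hz2) (posh z hz1 hz2) huz hev
      (hus z (inρ z hz0 hz2)) hsupV (hhs z (inσ z hz0 hz2))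
  refine ⟨K, τ, hτ0, hτm.le, fun x hx => ?_⟩
  have hx0 : 0 < bdist Ω x := bdist_pos_of_mem hN hΩo hΩb hx.1
  have hhx := hhp x (inσ x hx0 hx.2.le)
  rw [div_le_iff₀ hhx]
  have hlim := (hV0 (bdist Ω x) hx0).add_const (K * h x)
  rw [zero_add] at hlim
  refine ge_of_tendsto hlim ?_
  have e2 : ∀ᶠ t in nhdsWithin (0:ℝ) (Ioi 0), t < bdist Ω x :=
    nhdsWithin_le_nhds (gt_mem_nhds hx0)
  filter_upwards [e2, self_mem_nhdsWithin] with η h1 h2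
  exact comp η h2 x h1 hx.2
end
end
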